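/- Suppose b = 1, d_1 = d, A_1 ∈ ℝ^{d×d} is invertible, Assumptions (A0), (A2) and (A4) hold with m_1 > 0, and let θ* be the unique minimizer of θ ↦ U(θ) = U_1(A_1θ). Let ν = N(θ*, (M_1 A_1ᵀA_1)^{−1}) be the initial distribution and let 0 < ε ≤ 1. If ρ² ≤ ε/(d M_1) and t ≥ (log(2/ε) + C/2)/K_SGS, where K_SGS = m_1ρ²/(1 + m_1ρ²) and C = 5d/8 + (d/2)·log(M_1/m_1), then ‖νP_SGS^t − π‖_TV ≤ ε, where π(θ) ∝ exp(−U_1(A_1θ)). -/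

import Mathlib

/-!
STATEMENT 3: Complexity bound in TV distance for SGS, single splitting with
invertible A₁. Starting from ν = N(θ*, (M₁A₁ᵀA₁)⁻¹), if ρ² ≤ ε/(dM₁) and
t ≥ (log(2/ε) + C/2)/K_SGS with K_SGS = m₁ρ²/(1+m₁ρ²) and
C = 5d/8 + (d/2)log(M₁/m₁), then ‖νP_SGS^t − π‖_TV ≤ ε.
-/

open MeasureTheory Matrix
open scoped ENNReal RealInnerProductSpace

noncomputable section

abbrev EV (n : ℕ) := EuclideanSpace ℝ (Fin n)

/-- Action of a matrix on a Euclidean vector. -/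
def mvec {m n : ℕ} (A : Matrix (Fin m) (Fin n) ℝ) (x : EV n) : EV m :=
  (EuclideanSpace.equiv (Fin m) ℝ).symm (A.mulVec (EuclideanSpace.equiv (Fin n) ℝ x))

/-- Probability measure with (unnormalized) density `f` w.r.t. the volume measure. -/
def densMeasure {α : Type*} [MeasureSpace α] (f : α → ℝ) : Measure α :=
  (∫⁻ x, ENNReal.ofReal (f x))⁻¹ • (volume.withDensity fun x => ENNReal.ofReal (f x))

/-- Total variation distance between measures (sup over measurable sets). -/
def tvDist {α : Type*} [MeasurableSpace α] (μ ν : Measure α) : ℝ :=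
  sSup {r | ∃ s : Set α, MeasurableSet s ∧ r = |(μ s).toReal - (ν s).toReal|}

/-- Distribution after `t` steps of the Markov transition `P` started from `ν`. -/
def iterDist {α : Type*} [MeasurableSpace α] (P : α → Measure α) (ν : Measure α) : ℕ → Measure α
  | 0 => ν
  | t + 1 => (iterDist P ν t).bind P

/-- SGS transition kernel, single splitting with matrix A₁: draw z from the density
∝ exp(−U₁(z) − ‖z−A₁θ‖²/(2ρ²)), then θ' from N((A₁ᵀA₁)⁻¹A₁ᵀz, ρ²(A₁ᵀA₁)⁻¹). -/
def sgsKernelSingle {n : ℕ} (A₁ : Matrix (Fin n) (Fin n) ℝ) (U₁ : EV n → ℝ) (ρ : ℝ)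
    (θ : EV n) : Measure (EV n) :=
  (densMeasure fun z : EV n => Real.exp (-U₁ z - ‖z - mvec A₁ θ‖ ^ 2 / (2 * ρ ^ 2))).bind
    fun z =>
      densMeasure fun θ' : EV n =>
        Real.exp (-(⟪θ' - mvec (A₁ᵀ * A₁)⁻¹ (mvec A₁ᵀ z),
            mvec (A₁ᵀ * A₁) (θ' - mvec (A₁ᵀ * A₁)⁻¹ (mvec A₁ᵀ z))⟫ / (2 * ρ ^ 2)))

/-- one-dimensional Brunn-Minkowski, compact sets -/
theorem bm_compact {A B C : Set ℝ} (hA : IsCompact A) (hB : IsCompact B) 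
    (hAn : A.Nonempty) (hBn : B.Nonempty) (h : ∀ x ∈ A, ∀ y ∈ B, x + y ∈ C) :
    volume A + volume B ≤ volume C := by
  have hx := hA.sSup_mem hAn
  have hy := hB.sInf_mem hBn
  set x := sSup A with hxd
  set y := sInf B with hyd
  have h1 : volume ((fun t => t + (-y)) ⁻¹' A) = volume A := measure_preimage_add_right _ _ _
  have h2 : volume ((fun t => t + (-x)) ⁻¹' B) = volume B := measure_preimage_add_right _ _ _
  rw [← h1, ← h2, ← measure_union₀]
  · apply measure_mono
    rintro t (ht | ht)
    · have := h _ ht _ hy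
      simpa using this
    · have := h _ hx _ ht
      simpa using this
  · exact ((measurable_add_const _) hB.measurableSet).nullMeasurableSet
  · refine measure_mono_null (t := {x + y}) ?_ (by simp)
    rintro t ⟨ht1, ht2⟩
    have e1 : t + -y ≤ x := le_csSup hA.bddAbove ht1
    have e2 : y ≤ t + -x := csInf_le hB.bddBelow ht2
    simp only [Set.mem_singleton_iff]
    linarith

theorem bm_one {A B C : Set ℝ} (hA : MeasurableSet A) (hB : MeasurableSet B)
    (hAn : A.Nonempty) (hBn : B.Nonempty) (h : ∀ x ∈ A, ∀ y ∈ B, x + y ∈ C) :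
    volume A + volume B ≤ volume C := by
  obtain ⟨a, ha⟩ := hAn
  obtain ⟨b, hb⟩ := hBn
  have key : ∀ K ⊆ A, IsCompact K → ∀ L ⊆ B, IsCompact L → volume K + volume L ≤ volume C := by
    intro K hKA hK L hLB hL
    refine le_trans (add_le_add (measure_mono (Set.subset_insert a K)) 
      (measure_mono (Set.subset_insert b L))) ?_
    apply bm_compact (hK.insert a) (hL.insert b) (Set.insert_nonempty _ _) (Set.insert_nonempty _ _)
    intro x hx y hy
    exact h x (Set.insert_subset ha hKA hx) y (Set.insert_subset hb hLB hy)
  rw [hA.measure_eq_iSup_isCompact volume, hB.measure_eq_iSup_isCompact volume]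
  simp only [iSup_and']
  exact ENNReal.biSup_add_biSup_le' ⟨∅, by simp⟩ ⟨∅, by simp⟩
    fun K hK L hL => key K hK.1 hK.2 L hL.1 hL.2

theorem pl_core {a b : ℝ} (ha : 0 < a) (hb : 0 < b) (hab : a + b = 1) {f g h : ℝ → ℝ}
    (hf : Measurable f) (hg : Measurable g) (hh : Measurable h)
    (hf0 : ∀ x, 0 ≤ f x) (hg0 : ∀ x, 0 ≤ g x) (hh0 : ∀ x, 0 ≤ h x)
    (hf1 : ∀ x, f x ≤ 1) (hg1 : ∀ x, g x ≤ 1)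
    (hf2 : ∀ t < 1, ∃ x, t < f x) (hg2 : ∀ t < 1, ∃ x, t < g x)
    (hfg : ∀ x y, f x ^ a * g y ^ b ≤ h (a * x + b * y)) :
    ENNReal.ofReal a * (∫⁻ x, ENNReal.ofReal (f x)) + ENNReal.ofReal b * (∫⁻ x, ENNReal.ofReal (g x))
      ≤ ∫⁻ x, ENNReal.ofReal (h x) := by
  rw [lintegral_eq_lintegral_meas_lt _ (ae_of_all _ hf0) hf.aemeasurable,
    lintegral_eq_lintegral_meas_lt _ (ae_of_all _ hg0) hg.aemeasurable,
    lintegral_eq_lintegral_meas_lt _ (ae_of_all _ hh0) hh.aemeasurable]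
  have meas : ∀ φ : ℝ → ℝ, Measurable fun t : ℝ => volume {x | t < φ x} := by
    intro φ
    apply Antitone.measurable
    intro s t hst
    exact measure_mono fun x hx => lt_of_le_of_lt hst hx
  rw [← lintegral_const_mul _ (meas f), ← lintegral_const_mul _ (meas g), ← lintegral_add_left
    ((meas f).const_mul _)]
  apply setLIntegral_mono (meas h)
  intro t ht
  have ht : 0 < t := ht
  by_cases ht1 : t < 1
  · have vs : ∀ (c : ℝ) (hc : 0 < c) (S : Set ℝ), 
        volume ((fun x => c⁻¹ * x) ⁻¹' S) = ENNReal.ofReal c * volume S := by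
      intro c hc S
      rw [Real.volume_preimage_mul_left (inv_ne_zero hc.ne'), inv_inv, abs_of_pos hc]
    rw [← vs a ha, ← vs b hb]
    apply bm_one
    · exact (measurable_const_mul _) (measurableSet_lt measurable_const hf)
    · exact (measurable_const_mul _) (measurableSet_lt measurable_const hg)
    · obtain ⟨x, hx⟩ := hf2 t ht1
      exact ⟨a * x, by simpa [ha.ne'] using hx⟩
    · obtain ⟨x, hx⟩ := hg2 t ht1
      exact ⟨b * x, by simpa [hb.ne'] using hx⟩
    · intro x hx y hy
      have hx : t < f (a⁻¹ * x) := hx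
      have hy : t < g (b⁻¹ * y) := hy
      have := hfg (a⁻¹ * x) (b⁻¹ * y)
      rw [mul_inv_cancel_left₀ ha.ne', mul_inv_cancel_left₀ hb.ne'] at this
      refine lt_of_lt_of_le ?_ this
      calc t = t ^ a * t ^ b := by rw [← Real.rpow_add ht, hab, Real.rpow_one]
        _ < _ := mul_lt_mul'' (Real.rpow_lt_rpow ht.le hx ha) (Real.rpow_lt_rpow ht.le hy hb)
          (by positivity) (by positivity)
  · have e1 : {x | t < f x} = ∅ := by
      ext x; simp; linarith [hf1 x]
    have e2 : {x | t < g x} = ∅ := by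
      ext x; simp; linarith [hg1 x]
    simp [e1, e2]

theorem ennreal_amgm {a b : ℝ} (ha : 0 < a) (hb : 0 < b) (hab : a + b = 1) (x y : ℝ≥0∞) :
    x ^ a * y ^ b ≤ ENNReal.ofReal a * x + ENNReal.ofReal b * y := by
  by_cases hx : x = ∞
  · subst hx
    rw [ENNReal.mul_top (by simpa using ha)]; simp
  by_cases hy : y = ∞
  · subst hy
    rw [ENNReal.mul_top (by simpa using hb)]; simp
  lift x to NNReal using hx
  lift y to NNReal using hy
  lift a to NNReal using ha.le
  lift b to NNReal using hb.le
  have := NNReal.geom_mean_le_arith_mean2_weighted a b x y (by exact_mod_cast hab)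
  rw [← ENNReal.coe_rpow_of_nonneg _ ha.le, ← ENNReal.coe_rpow_of_nonneg _ hb.le,
    ENNReal.ofReal_coe_nnreal, ENNReal.ofReal_coe_nnreal]
  exact_mod_cast this

theorem pl_one_bdd {a b : ℝ} (ha : 0 < a) (hb : 0 < b) (hab : a + b = 1) {f g h : ℝ → ℝ≥0∞}
    (hf : Measurable f) (hg : Measurable g) (hh : Measurable h)
    (hfb : (⨆ x, f x) ≠ ∞) (hgb : (⨆ x, g x) ≠ ∞)
    (hfg : ∀ x y, f x ^ a * g y ^ b ≤ h (a * x + b * y)) :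
    (∫⁻ x, f x) ^ a * (∫⁻ x, g x) ^ b ≤ ∫⁻ x, h x := by
  set α := ⨆ x, f x with hα
  set β := ⨆ x, g x with hβ
  by_cases hα0 : α = 0
  · have : ∀ x, f x = 0 := by simpa [hα] using hα0
    simp [this, ha]
  by_cases hβ0 : β = 0
  · have : ∀ x, g x = 0 := by simpa [hβ] using hβ0
    simp [this, hb]
  have hfα : ∀ x, f x / α ≤ 1 := fun x => ENNReal.div_le_of_le_mul (by rw [one_mul]; exact le_iSup f x)
  have hgβ : ∀ x, g x / β ≤ 1 := fun x => ENNReal.div_le_of_le_mul (by rw [one_mul]; exact le_iSup g x)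
  have hft : ∀ x, f x / α ≠ ∞ := fun x => ne_top_of_le_ne_top ENNReal.one_ne_top (hfα x)
  have hgt : ∀ x, g x / β ≠ ∞ := fun x => ne_top_of_le_ne_top ENNReal.one_ne_top (hgβ x)
  set γ := α ^ a * β ^ b with hγ
  have hαa : α ^ a ≠ 0 := by simp [hα0, hfb]
  have hαt : α ^ a ≠ ∞ := by simp [hfb, ha.le]
  have hβa : β ^ b ≠ 0 := by simp [hβ0, hgb]
  have hβt : β ^ b ≠ ∞ := by simp [hgb, hb.le]
  have hγ0 : γ ≠ 0 := mul_ne_zero hαa hβa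
  have hγt : γ ≠ ∞ := ENNReal.mul_ne_top hαt hβt
  have hht : ∀ x, min (h x / γ) 1 ≠ ∞ := fun x => ne_top_of_le_ne_top ENNReal.one_ne_top (min_le_right _ _)
  have key := pl_core (f := fun x => (f x / α).toReal) (g := fun x => (g x / β).toReal)
    (h := fun x => (min (h x / γ) 1).toReal) ha hb hab (by fun_prop) (by fun_prop)
    (by fun_prop) (fun _ => ENNReal.toReal_nonneg) 
    (fun _ => ENNReal.toReal_nonneg) (fun _ => ENNReal.toReal_nonneg)
    (fun x => by simpa using ENNReal.toReal_mono ENNReal.one_ne_top (hfα x))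
    (fun x => by simpa using ENNReal.toReal_mono ENNReal.one_ne_top (hgβ x))
    ?_ ?_ ?_
  · simp only [ENNReal.ofReal_toReal (hft _), ENNReal.ofReal_toReal (hgt _),
      ENNReal.ofReal_toReal (hht _)] at key
    have key2 := (ennreal_amgm ha hb hab _ _).trans key
    have e3 : ∫⁻ x, min (h x / γ) 1 ≤ (∫⁻ x, h x) / γ := by
      simp only [div_eq_mul_inv]
      rw [← lintegral_mul_const _ hh]
      exact lintegral_mono fun x => min_le_left _ _
    have key3 := key2.trans e3
    simp only [div_eq_mul_inv] at key3
    rw [lintegral_mul_const _ hf, lintegral_mul_const _ hg, ← div_eq_mul_inv, ← div_eq_mul_inv,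
      ← div_eq_mul_inv, ENNReal.div_rpow_of_nonneg _ _ ha.le, ENNReal.div_rpow_of_nonneg _ _ hb.le,
      ENNReal.le_div_iff_mul_le (Or.inl hγ0) (Or.inl hγt)] at key3
    refine le_trans (le_of_eq ?_) key3
    rw [hγ, div_eq_mul_inv, div_eq_mul_inv]
    calc _ = (∫⁻ x, f x) ^ a * (∫⁻ x, g x) ^ b * ((α ^ a)⁻¹ * α ^ a) * ((β ^ b)⁻¹ * β ^ b) := by
          rw [ENNReal.inv_mul_cancel hαa hαt, ENNReal.inv_mul_cancel hβa hβt]; simp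
      _ = _ := by ring
  · intro t ht
    have : ENNReal.ofReal t * α < α := by
      conv_rhs => rw [← one_mul α]
      exact (ENNReal.mul_lt_mul_iff_left hα0 hfb).2 (by simpa using ht)
    obtain ⟨x, hx⟩ := lt_iSup_iff.1 this
    refine ⟨x, ?_⟩
    have := (ENNReal.lt_div_iff_mul_lt (Or.inl hα0) (Or.inl hfb)).2 hx
    rw [← ENNReal.ofReal_toReal (hft x)] at this
    exact (ENNReal.ofReal_lt_ofReal_iff'.1 this).1
  · intro t ht
    have : ENNReal.ofReal t * β < β := by
      conv_rhs => rw [← one_mul β]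
      exact (ENNReal.mul_lt_mul_iff_left hβ0 hgb).2 (by simpa using ht)
    obtain ⟨x, hx⟩ := lt_iSup_iff.1 this
    refine ⟨x, ?_⟩
    have := (ENNReal.lt_div_iff_mul_lt (Or.inl hβ0) (Or.inl hgb)).2 hx
    rw [← ENNReal.ofReal_toReal (hgt x)] at this
    exact (ENNReal.ofReal_lt_ofReal_iff'.1 this).1
  · intro x y
    rw [ENNReal.toReal_rpow, ENNReal.toReal_rpow, ← ENNReal.toReal_mul]
    apply ENNReal.toReal_mono (hht _)
    apply le_min
    · rw [ENNReal.div_rpow_of_nonneg _ _ ha.le, ENNReal.div_rpow_of_nonneg _ _ hb.le,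
        ENNReal.le_div_iff_mul_le (Or.inl hγ0) (Or.inl hγt)]
      refine le_trans (le_of_eq ?_) (hfg x y)
      rw [hγ, div_eq_mul_inv, div_eq_mul_inv]
      calc _ = f x ^ a * g y ^ b * ((α ^ a)⁻¹ * α ^ a) * ((β ^ b)⁻¹ * β ^ b) := by ring
        _ = _ := by
          rw [ENNReal.inv_mul_cancel hαa hαt, ENNReal.inv_mul_cancel hβa hβt]; simp
    · exact mul_le_one' (ENNReal.rpow_le_one (hfα x) ha.le) (ENNReal.rpow_le_one (hgβ y) hb.le)

theorem pl_one {a b : ℝ} (ha : 0 < a) (hb : 0 < b) (hab : a + b = 1) {f g h : ℝ → ℝ≥0∞}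
    (hf : Measurable f) (hg : Measurable g) (hh : Measurable h)
    (hfg : ∀ x y, f x ^ a * g y ^ b ≤ h (a * x + b * y)) :
    (∫⁻ x, f x) ^ a * (∫⁻ x, g x) ^ b ≤ ∫⁻ x, h x := by
  have trunc : ∀ φ : ℝ → ℝ≥0∞, Measurable φ → ∫⁻ x, φ x = ⨆ n : ℕ, ∫⁻ x, min (φ x) n := by
    intro φ hφ
    rw [← lintegral_iSup (fun n => hφ.min measurable_const)]
    · congr 1
      ext x
      rw [← inf_iSup_eq, ENNReal.iSup_natCast]; simp
    · intro m n hmn x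
      exact min_le_min_left _ (by exact_mod_cast hmn)
  have rp : ∀ (c : ℝ) (hc : 0 < c) (u : ℕ → ℝ≥0∞), (⨆ n, u n) ^ c = ⨆ n, u n ^ c := by
    intro c hc u
    exact (ENNReal.orderIsoRpow c hc).map_iSup u
  rw [trunc f hf, trunc g hg, rp a ha, rp b hb, ENNReal.iSup_mul]
  refine iSup_le fun n => ?_
  rw [ENNReal.mul_iSup]
  refine iSup_le fun m => ?_
  have bd : ∀ (φ : ℝ → ℝ≥0∞) (n : ℕ), (⨆ x, min (φ x) n) ≠ ∞ := fun φ n =>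
    ne_top_of_le_ne_top (ENNReal.natCast_ne_top n) (iSup_le fun x => min_le_right _ _)
  refine pl_one_bdd ha hb hab (hf.min measurable_const) (hg.min measurable_const) hh
    (bd f n) (bd g m) fun x y => le_trans ?_ (hfg x y)
  gcongr
  · exact min_le_left _ _
  · exact min_le_left _ _

theorem pl_pi {a b : ℝ} (ha : 0 < a) (hb : 0 < b) (hab : a + b = 1) (n : ℕ) :
    ∀ {f g h : (Fin n → ℝ) → ℝ≥0∞},
    Measurable f → Measurable g → Measurable h →
    (∀ x y, f x ^ a * g y ^ b ≤ h (a • x + b • y)) →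
    (∫⁻ x, f x) ^ a * (∫⁻ x, g x) ^ b ≤ ∫⁻ x, h x := by
  induction n with
  | zero =>
    intro f g h hf hg hh hfg
    have : ∀ φ : (Fin 0 → ℝ) → ℝ≥0∞, ∫⁻ x, φ x = φ 0 := by
      intro φ
      rw [lintegral_unique]
      rw [volume_pi, Measure.pi_of_empty (μ := fun _ : Fin 0 => volume) 0]
      simp only [measure_univ, mul_one]
      exact congrArg φ (Subsingleton.elim _ _)
    rw [this, this, this]
    simpa using hfg 0 0
  | succ n ih =>
    intro f g h hf hg hh hfg
    have split : ∀ φ : (Fin (n+1) → ℝ) → ℝ≥0∞, Measurable φ → 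
        ∫⁻ x, φ x = ∫⁻ t : ℝ, ∫⁻ y : Fin n → ℝ, φ (Fin.cons t y) := by
      intro φ hφ
      rw [← (volume_preserving_piFinSuccAbove (fun _ : Fin (n + 1) => ℝ) 0).symm.lintegral_comp hφ]
      rw [Measure.volume_eq_prod, lintegral_prod _ (by fun_prop)]
      simp [MeasurableEquiv.piFinSuccAbove, Fin.insertNthEquiv]
    have mc : ∀ φ : (Fin (n+1) → ℝ) → ℝ≥0∞, Measurable φ → 
        Measurable fun p : ℝ × (Fin n → ℝ) => φ (Fin.cons p.1 p.2) := by
      intro φ hφ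
      simpa [Function.comp_def, MeasurableEquiv.piFinSuccAbove, Fin.insertNthEquiv] using hφ.comp (MeasurableEquiv.piFinSuccAbove (fun _ : Fin (n + 1) => ℝ) 0).symm.measurable
    rw [split f hf, split g hg, split h hh]
    apply pl_one ha hb hab (mc f hf).lintegral_prod_right (mc g hg).lintegral_prod_right
      (mc h hh).lintegral_prod_right
    intro s t
    refine ih ((mc f hf).comp measurable_prodMk_left) ((mc g hg).comp measurable_prodMk_left)
      ((mc h hh).comp measurable_prodMk_left) ?_
    intro x y
    have := hfg (Fin.cons s x) (Fin.cons t y)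
    convert this using 2
    ext i
    refine Fin.cases ?_ (fun j => ?_) i <;> simp

theorem prekopa_leindler {a b : ℝ} (ha : 0 < a) (hb : 0 < b) (hab : a + b = 1) {n : ℕ}
    {f g h : EV n → ℝ≥0∞} (hf : Measurable f) (hg : Measurable g) (hh : Measurable h)
    (hfg : ∀ x y, f x ^ a * g y ^ b ≤ h (a • x + b • y)) :
    (∫⁻ x, f x) ^ a * (∫⁻ x, g x) ^ b ≤ ∫⁻ x, h x := by
  have mp := PiLp.volume_preserving_toLp (Fin n)
  rw [← mp.lintegral_comp hf, ← mp.lintegral_comp hg, ← mp.lintegral_comp hh]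
  exact pl_pi ha hb hab n (hf.comp mp.measurable) (hg.comp mp.measurable) (hh.comp mp.measurable)
    fun x y => hfg _ _

theorem jensen_exp {n : ℕ} {Y φ : EV n → ℝ} {y : ℝ} (hφ0 : ∀ x, 0 ≤ φ x) (hφ : Integrable φ)
    (hYφ : Integrable fun x => Y x * φ x) (he : Integrable fun x => Real.exp (Y x) * φ x)
    (hy : ∫ x, Y x * φ x = y * ∫ x, φ x) :
    Real.exp y * ∫ x, φ x ≤ ∫ x, Real.exp (Y x) * φ x := by
  have h1 : Integrable fun x => Real.exp y * (φ x + (Y x * φ x - y * φ x)) :=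
    (hφ.add (hYφ.sub (hφ.const_mul y))).const_mul _
  have h2 : ∫ x, Real.exp y * (φ x + (Y x * φ x - y * φ x)) = Real.exp y * ∫ x, φ x := by
    rw [integral_const_mul, integral_add hφ (show Integrable fun x => Y x * φ x - y * φ x from hYφ.sub (hφ.const_mul y)),
      integral_sub hYφ (hφ.const_mul y), integral_const_mul, hy]
    ring
  rw [← h2]
  refine integral_mono h1 he fun x => ?_
  have : Real.exp y * (1 + (Y x - y)) ≤ Real.exp (Y x) := by
    have := Real.add_one_le_exp (Y x - y)
    calc Real.exp y * (1 + (Y x - y)) ≤ Real.exp y * Real.exp (Y x - y) := by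
          apply mul_le_mul_of_nonneg_left _ (Real.exp_pos _).le; linarith
      _ = Real.exp (Y x) := by rw [← Real.exp_add]; ring_nf
  have := mul_le_mul_of_nonneg_right this (hφ0 x)
  dsimp only
  linarith

theorem strong_conv {n : ℕ} {V : EV n → ℝ} {K : ℝ}
    (hconv : ConvexOn ℝ Set.univ fun z => V z - K / 2 * ‖z‖ ^ 2) {a b : ℝ} (ha : 0 ≤ a) (hb : 0 ≤ b)
    (hab : a + b = 1) (x y : EV n) :
    V (a • x + b • y) ≤ a * V x + b * V y - K / 2 * (a * b * ‖x - y‖ ^ 2) := by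
  have h := hconv.2 (Set.mem_univ x) (Set.mem_univ y) ha hb hab
  simp only [smul_eq_mul] at h
  have e : ‖a • x + b • y‖ ^ 2 = a * ‖x‖ ^ 2 + b * ‖y‖ ^ 2 - a * b * ‖x - y‖ ^ 2 := by
    rw [norm_add_sq_real, norm_sub_sq_real, norm_smul, norm_smul, inner_smul_left, inner_smul_right]
    simp only [Real.norm_eq_abs, mul_pow, sq_abs, conj_trivial]
    have : b = 1 - a := by linarith
    subst this; ring
  rw [e] at h
  linarith

theorem conc_aux {n : ℕ} {V g : EV n → ℝ} {K L : ℝ} (hV : Continuous V) (hg : Continuous g)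
    (hK : 0 < K) (hconv : ConvexOn ℝ Set.univ fun z => V z - K / 2 * ‖z‖ ^ 2)
    (hL : ∀ x y, |g x - g y| ≤ L * ‖x - y‖)
    (hVi : Integrable fun z => Real.exp (-V z)) (hgi : Integrable fun z => g z * Real.exp (-V z))
    (hg0 : ∫ z, g z * Real.exp (-V z) = 0) {a b : ℝ} (ha : 0 < a) (hb : 0 < b) (hab : a + b = 1) :
    ∫⁻ z, ENNReal.ofReal (Real.exp (g z - V z)) ≤
      ENNReal.ofReal (Real.exp (L ^ 2 / (2 * K * b)) * ∫ z, Real.exp (-V z)) := by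
  have hz : 0 < ∫ z, Real.exp (-V z) := integral_exp_pos hVi
  set z := ∫ z, Real.exp (-V z) with hzd
  set X := ∫⁻ z, ENNReal.ofReal (Real.exp (g z - V z)) with hX
  set c := L ^ 2 / (2 * K * b) with hc
  have pl := prekopa_leindler ha hb hab (f := fun z => ENNReal.ofReal (Real.exp (g z - V z)))
    (g := fun z => ENNReal.ofReal (Real.exp (-(a / b) * g z - V z)))
    (h := fun z => ENNReal.ofReal (Real.exp (a * c) * Real.exp (-V z)))
    (by fun_prop) (by fun_prop) (by fun_prop) ?_
  · have h3 : ∫⁻ z, ENNReal.ofReal (Real.exp (a * c) * Real.exp (-V z)) 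
        = ENNReal.ofReal (Real.exp (a * c) * z) := by
      rw [← ofReal_integral_eq_lintegral_ofReal (hVi.const_mul _) (ae_of_all _ fun x => by positivity),
        integral_const_mul]
    have h2 : ENNReal.ofReal z ≤ ∫⁻ z, ENNReal.ofReal (Real.exp (-(a / b) * g z - V z)) := by
      by_cases htop : ∫⁻ z, ENNReal.ofReal (Real.exp (-(a / b) * g z - V z)) = ∞
      · rw [htop]; exact le_top
      have hIntg : Integrable fun z => Real.exp (-(a / b) * g z - V z) :=
        (lintegral_ofReal_ne_top_iff_integrable (by fun_prop) 
          (ae_of_all _ fun x => (Real.exp_pos _).le)).1 htop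
      rw [← ofReal_integral_eq_lintegral_ofReal hIntg (ae_of_all _ fun x => (Real.exp_pos _).le)]
      apply ENNReal.ofReal_le_ofReal
      have := jensen_exp (Y := fun z => -(a / b) * g z) (φ := fun z => Real.exp (-V z)) (y := 0)
        (fun x => (Real.exp_pos _).le) hVi
        (by simpa only [mul_assoc] using hgi.const_mul (-(a / b)))
        (by simpa only [← Real.exp_add, ← sub_eq_add_neg] using hIntg)
        (by simp only [mul_assoc]; rw [integral_const_mul, hg0]; simp)
      simpa only [← Real.exp_add, ← sub_eq_add_neg, Real.exp_zero, one_mul] using this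
    rw [h3, ← hX] at pl
    have h4 := (mul_le_mul_right (ENNReal.rpow_le_rpow h2 hb.le) (X ^ a)).trans pl
    have h5 : ENNReal.ofReal (Real.exp (a * c) * z) = 
        ENNReal.ofReal (Real.exp c * z) ^ a * ENNReal.ofReal z ^ b := by
      rw [ENNReal.ofReal_rpow_of_pos (by positivity), ENNReal.ofReal_rpow_of_pos hz,
        ← ENNReal.ofReal_mul (by positivity), Real.mul_rpow (Real.exp_pos _).le hz.le,
        ← Real.exp_mul, mul_assoc, ← Real.rpow_add hz, hab, Real.rpow_one, mul_comm a c]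
    rw [h5] at h4
    have hzb0 : ENNReal.ofReal z ^ b ≠ 0 := by
      rw [ENNReal.ofReal_rpow_of_pos hz]; simpa using Real.rpow_pos_of_pos hz b
    have hzbt : ENNReal.ofReal z ^ b ≠ ∞ := by
      rw [ENNReal.ofReal_rpow_of_pos hz]; exact ENNReal.ofReal_ne_top
    exact (ENNReal.rpow_le_rpow_iff ha).1 ((ENNReal.mul_le_mul_iff_left hzb0 hzbt).1 h4)
  · intro x y
    rw [ENNReal.ofReal_rpow_of_pos (Real.exp_pos _), ENNReal.ofReal_rpow_of_pos (Real.exp_pos _),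
      ← ENNReal.ofReal_mul (by positivity)]
    apply ENNReal.ofReal_le_ofReal
    rw [← Real.exp_mul, ← Real.exp_mul, ← Real.exp_add, ← Real.exp_add]
    apply Real.exp_le_exp.2
    have h1 := strong_conv hconv ha.le hb.le hab x y
    have h2 := (abs_le.1 (hL x y)).2
    have h3 : L * ‖x - y‖ ≤ c + K * b / 2 * ‖x - y‖ ^ 2 := by
      have : c + K * b / 2 * ‖x - y‖ ^ 2 - L * ‖x - y‖ = (L - K * b * ‖x - y‖) ^ 2 / (2 * K * b) := by
        rw [hc]; field_simp; ring
      have : 0 ≤ (L - K * b * ‖x - y‖) ^ 2 / (2 * K * b) := by positivity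
      linarith
    have h4 : a * (g x - g y) ≤ a * (c + K * b / 2 * ‖x - y‖ ^ 2) := 
      mul_le_mul_of_nonneg_left (h2.trans h3) ha.le
    have h5 : (-(a / b) * g y - V y) * b = - a * g y - b * V y := by field_simp
    rw [h5]
    nlinarith

theorem conc {n : ℕ} {V g : EV n → ℝ} {K L : ℝ} (hV : Continuous V) (hg : Continuous g)
    (hK : 0 < K) (hconv : ConvexOn ℝ Set.univ fun z => V z - K / 2 * ‖z‖ ^ 2)
    (hL : ∀ x y, |g x - g y| ≤ L * ‖x - y‖)
    (hVi : Integrable fun z => Real.exp (-V z)) (hgi : Integrable fun z => g z * Real.exp (-V z))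
    (hg0 : ∫ z, g z * Real.exp (-V z) = 0) :
    Integrable (fun z => Real.exp (g z - V z)) ∧
    ∫ z, Real.exp (g z - V z) ≤ Real.exp (L ^ 2 / (2 * K)) * ∫ z, Real.exp (-V z) := by
  have hz : 0 < ∫ z, Real.exp (-V z) := integral_exp_pos hVi
  have aux := fun {a b : ℝ} => conc_aux (a := a) (b := b) hV hg hK hconv hL hVi hgi hg0
  have hIntg : Integrable fun z => Real.exp (g z - V z) := by
    refine (lintegral_ofReal_ne_top_iff_integrable (by fun_prop) 
          (ae_of_all _ fun x => (Real.exp_pos _).le)).1 ?_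
    exact ne_top_of_le_ne_top ENNReal.ofReal_ne_top (aux (a := 1/2) (b := 1/2) (by norm_num)
      (by norm_num) (by norm_num))
  refine ⟨hIntg, ?_⟩
  have h1 : ∀ᶠ b : ℝ in nhdsWithin 1 (Set.Iio 1), ∫ z, Real.exp (g z - V z) ≤ 
      Real.exp (L ^ 2 / (2 * K * b)) * ∫ z, Real.exp (-V z) := by
    filter_upwards [Ioo_mem_nhdsLT (show (0:ℝ) < 1 by norm_num)] with b hb
    have := aux (a := 1 - b) (b := b) (by linarith [hb.2]) hb.1 (by ring)
    rw [← ofReal_integral_eq_lintegral_ofReal hIntg (ae_of_all _ fun x => (Real.exp_pos _).le)] at this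
    exact (ENNReal.ofReal_le_ofReal_iff (by positivity)).1 this
  have h2 : Filter.Tendsto (fun b : ℝ => Real.exp (L ^ 2 / (2 * K * b)) * ∫ z, Real.exp (-V z))
      (nhdsWithin 1 (Set.Iio 1)) (nhds (Real.exp (L ^ 2 / (2 * K)) * ∫ z, Real.exp (-V z))) := by
    have : ContinuousAt (fun b : ℝ => Real.exp (L ^ 2 / (2 * K * b)) * ∫ z, Real.exp (-V z)) 1 := by
      refine ContinuousAt.mul (Real.continuous_exp.continuousAt.comp ?_) continuousAt_const
      exact ContinuousAt.div continuousAt_const (by fun_prop) (by simp [hK.ne'])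
    have := this.tendsto
    rw [mul_one] at this
    exact this.mono_left nhdsWithin_le_nhds
  exact ge_of_tendsto h2 h1

theorem tilt_le {n : ℕ} {V V' h : EV n → ℝ} {K L B : ℝ} (a : EV n) (hV : Continuous V) 
    (hh : Continuous h)
    (hK : 0 < K) (hconv : ConvexOn ℝ Set.univ fun z => V z - K / 2 * ‖z‖ ^ 2)
    (hconv' : ConvexOn ℝ Set.univ fun z => V' z - K / 2 * ‖z‖ ^ 2)
    (hV' : ∀ z, V' z = V z - ⟪a, z⟫)
    (hL0 : 0 < L) (hL : ∀ x y, |h x - h y| ≤ L * ‖x - y‖) (hB : ∀ x, |h x| ≤ B)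
    (hVi : Integrable fun z => Real.exp (-V z)) (hVi' : Integrable fun z => Real.exp (-V' z))
    (hai : Integrable fun z => ⟪a, z⟫ * Real.exp (-V' z)) :
    (∫ z, h z * Real.exp (-V' z)) / (∫ z, Real.exp (-V' z)) - 
      (∫ z, h z * Real.exp (-V z)) / (∫ z, Real.exp (-V z)) ≤ L * ‖a‖ / K := by
  by_cases ha : a = 0
  · subst ha
    have : V' = V := by ext z; simp [hV']
    simp [this]
  have hna : 0 < ‖a‖ := norm_pos_iff.2 ha
  have hVc' : Continuous V' := by
    have : V' = fun z => V z - ⟪a, z⟫ := funext hV'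
    rw [this]; fun_prop
  have bi : ∀ {W f : EV n → ℝ} {C : ℝ}, Continuous f → (∀ x, |f x| ≤ C) → 
      Integrable (fun z => Real.exp (-W z)) → Integrable (fun z => f z * Real.exp (-W z)) := by
    intro W f C hf hC hW
    exact hW.bdd_mul hf.aestronglyMeasurable (ae_of_all _ hC)
  have hz : 0 < ∫ z, Real.exp (-V z) := integral_exp_pos hVi
  have hz' : 0 < ∫ z, Real.exp (-V' z) := integral_exp_pos hVi'
  set Z := ∫ z, Real.exp (-V z) with hZ
  set Z' := ∫ z, Real.exp (-V' z) with hZ'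
  set c := (∫ z, h z * Real.exp (-V z)) / Z with hc
  set c' := (∫ z, h z * Real.exp (-V' z)) / Z' with hc'
  set e := (∫ z, ⟪a, z⟫ * Real.exp (-V' z)) / Z' with he
  have hcZ : ∫ z, h z * Real.exp (-V z) = c * Z := by rw [hc]; field_simp
  have hcZ' : ∫ z, h z * Real.exp (-V' z) = c' * Z' := by rw [hc']; field_simp
  have heZ' : ∫ z, ⟪a, z⟫ * Real.exp (-V' z) = e * Z' := by rw [he]; field_simp
  have s1 := (conc (V := V') (g := fun z => e - ⟪a, z⟫) (L := ‖a‖) hVc' (by fun_prop) hK hconv' 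
    (fun x y => by
      rw [show e - ⟪a, x⟫ - (e - ⟪a, y⟫) = - ⟪a, x - y⟫ by rw [inner_sub_right]; ring, abs_neg]
      exact abs_real_inner_le_norm _ _) hVi' 
    (by simp only [sub_mul]; exact (hVi'.const_mul e).sub hai)
    (by simp only [sub_mul]
        rw [integral_sub (hVi'.const_mul e) hai, integral_const_mul, heZ']; ring)).2
  have s1' : Real.exp e * Z ≤ Real.exp (‖a‖ ^ 2 / (2 * K)) * Z' := by
    rw [hZ, ← integral_const_mul]
    have : ∀ z, Real.exp e * Real.exp (-V z) = Real.exp (e - ⟪a, z⟫ - V' z) := fun z => by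
      rw [← Real.exp_add, hV']; ring_nf
    simp only [this]
    exact s1
  set l := ‖a‖ / L with hl
  have hl0 : 0 < l := by positivity
  have hbd : ∀ x, |l * (h x - c)| ≤ l * (B + |c|) := fun x => by
    rw [abs_mul, abs_of_pos hl0]
    exact mul_le_mul_of_nonneg_left ((abs_sub _ _).trans (by linarith [hB x])) hl0.le
  have s2 := conc (V := V) (g := fun z => l * (h z - c)) (L := ‖a‖) hV (by fun_prop) hK hconv
    (fun x y => by
      rw [show l * (h x - c) - l * (h y - c) = l * (h x - h y) by ring, abs_mul, abs_of_pos hl0]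
      calc l * |h x - h y| ≤ l * (L * ‖x - y‖) := mul_le_mul_of_nonneg_left (hL x y) hl0.le
        _ = ‖a‖ * ‖x - y‖ := by rw [hl]; field_simp) hVi
    (bi (by fun_prop) hbd hVi)
    (by simp only [mul_assoc, sub_mul]
        rw [integral_const_mul, integral_sub (bi hh hB hVi) (hVi.const_mul c), hcZ, 
          integral_const_mul]; simp [hZ])
  have e3 : ∀ z, Real.exp (l * (h z - c) - ⟪a, z⟫) * Real.exp (-V' z) = 
      Real.exp (l * (h z - c) - V z) := by
    intro z; rw [← Real.exp_add, hV']; ring_nf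
  have s3 := jensen_exp (Y := fun z => l * (h z - c) - ⟪a, z⟫) (φ := fun z => Real.exp (-V' z))
    (y := l * (c' - c) - e) (fun x => (Real.exp_pos _).le) hVi'
    (by simp only [sub_mul _ (⟪a, _⟫) _]; exact (bi (by fun_prop) hbd hVi').sub hai)
    (by simp only [e3]; exact s2.1) 
    (by simp only [sub_mul _ (⟪a, _⟫) _]
        rw [integral_sub (bi (by fun_prop) hbd hVi') hai, heZ']
        simp only [mul_assoc, sub_mul _ c]
        rw [integral_const_mul, integral_sub (bi hh hB hVi') (hVi'.const_mul c), hcZ', 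
          integral_const_mul]; ring)
  simp only [e3] at s3
  have s4 := s3.trans s2.2
  have s5 : Real.exp (l * (c' - c) - e) * Real.exp e * Z' ≤ 
      Real.exp (‖a‖ ^ 2 / (2 * K)) * (Real.exp (‖a‖ ^ 2 / (2 * K)) * Z') := by
    calc _ = Real.exp e * (Real.exp (l * (c' - c) - e) * Z') := by ring
      _ ≤ Real.exp e * (Real.exp (‖a‖ ^ 2 / (2 * K)) * Z) := 
        mul_le_mul_of_nonneg_left s4 (Real.exp_pos _).le
      _ = Real.exp (‖a‖ ^ 2 / (2 * K)) * (Real.exp e * Z) := by ring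
      _ ≤ _ := mul_le_mul_of_nonneg_left s1' (Real.exp_pos _).le
  rw [← mul_assoc] at s5
  have s6 := le_of_mul_le_mul_right s5 hz'
  rw [← Real.exp_add, ← Real.exp_add, Real.exp_le_exp] at s6
  have s7 : l * (c' - c) ≤ ‖a‖ ^ 2 / K := by
    have : ‖a‖ ^ 2 / K = ‖a‖ ^ 2 / (2 * K) + ‖a‖ ^ 2 / (2 * K) := by field_simp; norm_num
    linarith
  have s8 : ‖a‖ ^ 2 / K = l * (L * ‖a‖ / K) := by rw [hl]; field_simp
  rw [s8] at s7
  exact le_of_mul_le_mul_left s7 hl0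

structure Nice {n : ℕ} (L B : ℝ) (g : EV n → ℝ) : Prop where
  cont : Continuous g
  bdd : ∀ x, |g x| ≤ B
  lip : ∀ x y, |g x - g y| ≤ L * ‖x - y‖

def gm {n : ℕ} (ρ : ℝ) (v : EV n) : ℝ := Real.exp (-(‖v‖ ^ 2 / (2 * ρ ^ 2)))

def Gf {n : ℕ} (U : EV n → ℝ) (ρ : ℝ) (w z : EV n) : ℝ :=
  Real.exp (-U z - ‖z - w‖ ^ 2 / (2 * ρ ^ 2))

def Wf {n : ℕ} (U : EV n → ℝ) (ρ : ℝ) (w : EV n) : ℝ := ∫ z, Gf U ρ w z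

def cg (n : ℕ) (ρ : ℝ) : ℝ := ∫ v : EV n, gm ρ v

def Tf {n : ℕ} (ρ : ℝ) (g : EV n → ℝ) (z : EV n) : ℝ := (∫ w, g w * gm ρ (w - z)) / cg n ρ

def Sf {n : ℕ} (U : EV n → ℝ) (ρ : ℝ) (h : EV n → ℝ) (w : EV n) : ℝ :=
  (∫ z, h z * Gf U ρ w z) / Wf U ρ w

theorem gm_continuous {n : ℕ} (ρ : ℝ) : Continuous (gm (n := n) ρ) := by
  unfold gm; fun_prop

theorem gauss_integrable {n : ℕ} {b : ℝ} (hb : 0 < b) :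
    Integrable fun v : EV n => Real.exp (-b * ‖v‖ ^ 2) := by
  have h := GaussianFourier.integrable_cexp_neg_mul_sq_norm_add_of_euclideanSpace
    (ι := Fin n) (b := (b : ℂ)) (by rwa [Complex.ofReal_re]) 0 0
  refine h.norm.congr (ae_of_all _ fun v => ?_)
  have e : -(b : ℂ) * (‖v‖ : ℂ) ^ 2 + 0 * ((⟪(0 : EV n), v⟫ : ℝ) : ℂ) = ((-b * ‖v‖ ^ 2 : ℝ) : ℂ) := by
    push_cast; ring
  simp only [e, Complex.norm_exp, Complex.ofReal_re]

theorem gm_integrable {n : ℕ} {ρ : ℝ} (hρ : 0 < ρ) : Integrable (gm (n := n) ρ) := by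
  refine (gauss_integrable (n := n) (b := 1 / (2 * ρ ^ 2)) (by positivity)).congr
    (ae_of_all _ fun v => ?_)
  simp only [gm]
  congr 1
  ring

theorem cg_pos {n : ℕ} {ρ : ℝ} (hρ : 0 < ρ) : 0 < cg n ρ := integral_exp_pos (gm_integrable hρ)

theorem gm_shift_integrable {n : ℕ} {ρ : ℝ} (hρ : 0 < ρ) (z : EV n) :
    Integrable fun w : EV n => gm ρ (w - z) := (gm_integrable hρ).comp_sub_right z

theorem gm_pos {n : ℕ} (ρ : ℝ) (v : EV n) : 0 < gm ρ v := Real.exp_pos _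

theorem Gf_pos {n : ℕ} (U : EV n → ℝ) (ρ : ℝ) (w z : EV n) : 0 < Gf U ρ w z := Real.exp_pos _

theorem Gf_eq {n : ℕ} (U : EV n → ℝ) (ρ : ℝ) (w z : EV n) :
    Gf U ρ w z = Real.exp (-U z) * gm ρ (w - z) := by
  rw [Gf, gm, ← Real.exp_add, norm_sub_rev]; rfl

theorem Gf_continuous {n : ℕ} {U : EV n → ℝ} (hU : Continuous U) (ρ : ℝ) :
    Continuous fun p : EV n × EV n => Gf U ρ p.1 p.2 := by
  unfold Gf; fun_prop

theorem Gf_integrable_prod {n : ℕ} {U : EV n → ℝ} 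
    (hUi : Integrable fun z => Real.exp (-U z)) {ρ : ℝ} (hρ : 0 < ρ) :
    Integrable (fun p : EV n × EV n => Gf U ρ p.1 p.2) (volume.prod volume) := by
  have := hUi.convolution_integrand (ContinuousLinearMap.mul ℝ ℝ) (gm_integrable (n := n) hρ)
  simpa [Gf_eq] using this

theorem Gf_integrable {n : ℕ} {U : EV n → ℝ} (hU : Continuous U)
    (hUi : Integrable fun z => Real.exp (-U z)) (ρ : ℝ) (w : EV n) : Integrable (Gf U ρ w) := by
  refine hUi.mono' ?_ (ae_of_all _ fun z => ?_)
  · exact ((Gf_continuous hU ρ).comp (by fun_prop : Continuous fun z => (w, z))).aestronglyMeasurable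
  · rw [Real.norm_eq_abs, abs_of_pos (Gf_pos _ _ _ _), Gf]
    apply Real.exp_le_exp.2
    have : 0 ≤ ‖z - w‖ ^ 2 / (2 * ρ ^ 2) := by positivity
    linarith

theorem Wf_pos {n : ℕ} {U : EV n → ℝ} (hU : Continuous U)
    (hUi : Integrable fun z => Real.exp (-U z)) (ρ : ℝ) (w : EV n) : 0 < Wf U ρ w := 
  integral_exp_pos (Gf_integrable hU hUi ρ w)

theorem Wf_integrable {n : ℕ} {U : EV n → ℝ} 
    (hUi : Integrable fun z => Real.exp (-U z)) {ρ : ℝ} (hρ : 0 < ρ) : Integrable (Wf U ρ) :=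
  (Gf_integrable_prod hUi hρ).integral_prod_left

/-- weighted average of a bounded function is bounded -/
theorem avg_bdd {n : ℕ} {h φ : EV n → ℝ} {B : ℝ} (hB : ∀ x, |h x| ≤ B)
    (hφ : Integrable φ) (hφ0 : ∀ x, 0 ≤ φ x) (hp : 0 < ∫ x, φ x) :
    |(∫ x, h x * φ x) / ∫ x, φ x| ≤ B := by
  rw [abs_div, abs_of_pos hp, div_le_iff₀ hp, ← integral_const_mul]
  refine (abs_integral_le_integral_abs).trans ?_
  refine integral_mono_of_nonneg (ae_of_all _ fun x => abs_nonneg _) (hφ.const_mul B) 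
    (ae_of_all _ fun x => ?_)
  simp only
  rw [abs_mul, abs_of_nonneg (hφ0 x)]
  exact mul_le_mul_of_nonneg_right (hB x) (hφ0 x)

theorem lip_cont {n : ℕ} {g : EV n → ℝ} {L : ℝ} (hL : ∀ x y, |g x - g y| ≤ L * ‖x - y‖) :
    Continuous g := by
  refine (LipschitzWith.of_dist_le' (K := L) fun x y => ?_).continuous
  rw [Real.dist_eq, dist_eq_norm]; exact hL x y

theorem Tf_alt {n : ℕ} (ρ : ℝ) (g : EV n → ℝ) (z : EV n) : 
    Tf ρ g z = (∫ v, g (v + z) * gm ρ v) / cg n ρ := by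
  rw [Tf, ← integral_add_right_eq_self (fun w => g w * gm ρ (w - z)) z]
  simp

theorem Nice.T {n : ℕ} {L B ρ : ℝ} {g : EV n → ℝ} (hρ : 0 < ρ) (hg : Nice L B g) :
    Nice L B (Tf ρ g) := by
  have hl : ∀ x y, |Tf ρ g x - Tf ρ g y| ≤ L * ‖x - y‖ := by
    intro x y
    have bi : ∀ x, Integrable fun v => g (v + x) * gm ρ v := fun x => 
      (gm_integrable hρ).bdd_mul (c := B) ((hg.cont.comp (by fun_prop)).aestronglyMeasurable) 
        (ae_of_all _ fun v => hg.bdd _)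
    rw [Tf_alt, Tf_alt, ← sub_div, ← integral_sub (bi x) (bi y)]
    simp only [← sub_mul]
    exact avg_bdd (fun v => by simpa using hg.lip (v + x) (v + y)) (gm_integrable hρ) 
      (fun x => (gm_pos _ _).le) (cg_pos hρ)
  exact ⟨lip_cont hl, fun x => by
    rw [Tf_alt]
    exact avg_bdd (fun v => hg.bdd _) (gm_integrable hρ) (fun x => (gm_pos _ _).le) (cg_pos hρ), hl⟩

theorem Sf_diff {n : ℕ} {U h : EV n → ℝ} {m L B ρ : ℝ} (hU : Continuous U) (hm : 0 < m)
    (hUi : Integrable fun z => Real.exp (-U z)) (hρ : 0 < ρ)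
    (hsc : ConvexOn ℝ Set.univ fun z => U z - m / 2 * ‖z‖ ^ 2)
    (hL : 0 < L) (hh : Nice L B h) (w w' : EV n) : 
    Sf U ρ h w' - Sf U ρ h w ≤ (L / (1 + m * ρ ^ 2)) * ‖w' - w‖ := by
  set Vt : EV n → EV n → ℝ := fun w z => U z + ‖z‖ ^ 2 / (2 * ρ ^ 2) - ⟪(ρ ^ 2)⁻¹ • w, z⟫ with hVt
  have hG : ∀ w z, Real.exp (-Vt w z) = Real.exp (‖w‖ ^ 2 / (2 * ρ ^ 2)) * Gf U ρ w z := by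
    intro w z
    rw [Gf, ← Real.exp_add, norm_sub_sq_real, real_inner_comm]
    congr 1
    simp only [hVt, inner_smul_left, conj_trivial]
    field_simp
    ring
  have hi : ∀ w, Integrable fun z => Real.exp (-Vt w z) := by
    intro w
    simp only [hG]
    exact (Gf_integrable hU hUi ρ w).const_mul _
  have hc : ∀ w, Continuous (Vt w) := by intro w; simp only [hVt]; fun_prop
  have hS : ∀ w, Sf U ρ h w = (∫ z, h z * Real.exp (-Vt w z)) / (∫ z, Real.exp (-Vt w z)) := by
    intro w
    simp only [hG]
    have : ∀ z, h z * (Real.exp (‖w‖ ^ 2 / (2 * ρ ^ 2)) * Gf U ρ w z) = 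
      Real.exp (‖w‖ ^ 2 / (2 * ρ ^ 2)) * (h z * Gf U ρ w z) := fun z => by ring
    simp only [this]
    rw [integral_const_mul, integral_const_mul, mul_div_mul_left _ _ (Real.exp_pos _).ne']
    rfl
  have hconv : ∀ w, ConvexOn ℝ Set.univ fun z => Vt w z - (m + 1 / ρ ^ 2) / 2 * ‖z‖ ^ 2 := by
    intro w
    have h1 : ConvexOn ℝ Set.univ fun z : EV n => ⟪-((ρ ^ 2)⁻¹ • w), z⟫ :=
      (innerSL ℝ (-((ρ ^ 2)⁻¹ • w))).toLinearMap.convexOn convex_univ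
    refine (hsc.add h1).congr fun z _ => ?_
    simp only [hVt, Pi.add_apply, inner_neg_left]
    field_simp
    ring
  have hV' : ∀ z, Vt w' z = Vt w z - ⟪(ρ ^ 2)⁻¹ • (w' - w), z⟫ := by
    intro z
    simp only [hVt, smul_sub, inner_sub_left]; ring
  rw [hS, hS]
  have key := tilt_le (V := Vt w) (V' := Vt w') (K := m + 1 / ρ ^ 2) (L := L) (B := B) 
    ((ρ ^ 2)⁻¹ • (w' - w)) (hc w) hh.cont (by positivity) (hconv w) (hconv w') hV' hL hh.lip hh.bdd
    (hi w) (hi w') ?_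
  · refine key.trans (le_of_eq ?_)
    rw [norm_smul, Real.norm_of_nonneg (by positivity)]
    field_simp
    ring
  · refine ((hi (w' + (w' - w))).add (hi (w' - (w' - w)))).mono' ?_ (ae_of_all _ fun z => ?_)
    · have := hc w'
      exact Continuous.aestronglyMeasurable (by fun_prop)
    · have e1 : Vt (w' + (w' - w)) z = Vt w' z - ⟪(ρ ^ 2)⁻¹ • (w' - w), z⟫ := by
        simp only [hVt, smul_add, inner_add_left]; ring
      have e2 : Vt (w' - (w' - w)) z = Vt w' z + ⟪(ρ ^ 2)⁻¹ • (w' - w), z⟫ := by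
        simp only [hVt, smul_sub, inner_sub_left]; ring
      rw [Pi.add_apply, e1, e2]
      set x := ⟪(ρ ^ 2)⁻¹ • (w' - w), z⟫
      rw [norm_mul, Real.norm_of_nonneg (Real.exp_pos (-Vt w' z)).le, Real.norm_eq_abs]
      rw [show -(Vt w' z - x) = x + -Vt w' z by ring, show -(Vt w' z + x) = -x + -Vt w' z by ring,
        Real.exp_add, Real.exp_add, ← add_mul]
      refine mul_le_mul_of_nonneg_right ?_ (Real.exp_pos _).le
      have f1 := Real.add_one_le_exp x
      have f2 := Real.add_one_le_exp (-x)
      have f3 := Real.exp_pos x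
      have f4 := Real.exp_pos (-x)
      exact abs_le.2 ⟨by linarith, by linarith⟩

theorem Nice.S {n : ℕ} {U h : EV n → ℝ} {m L B ρ : ℝ} (hU : Continuous U) (hm : 0 < m)
    (hUi : Integrable fun z => Real.exp (-U z)) (hρ : 0 < ρ)
    (hsc : ConvexOn ℝ Set.univ fun z => U z - m / 2 * ‖z‖ ^ 2)
    (hL : 0 < L) (hh : Nice L B h) : Nice (L / (1 + m * ρ ^ 2)) B (Sf U ρ h) := by
  have hl : ∀ x y, |Sf U ρ h x - Sf U ρ h y| ≤ L / (1 + m * ρ ^ 2) * ‖x - y‖ := by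
    intro x y
    have h1 := Sf_diff hU hm hUi hρ hsc hL hh y x
    have h2 := Sf_diff hU hm hUi hρ hsc hL hh x y
    rw [norm_sub_rev y x] at h2
    exact abs_le.2 ⟨by linarith, by linarith⟩
  exact ⟨lip_cont hl, fun x => avg_bdd hh.bdd (Gf_integrable hU hUi ρ x) 
    (fun z => (Gf_pos _ _ _ _).le) (Wf_pos hU hUi ρ x), hl⟩

theorem ST_adj {n : ℕ} {U g h : EV n → ℝ} {ρ B C : ℝ} (hU : Continuous U)
    (hUi : Integrable fun z => Real.exp (-U z)) (hρ : 0 < ρ)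
    (hg : Continuous g) (hgB : ∀ x, |g x| ≤ B) (hh : Continuous h) (hhB : ∀ x, |h x| ≤ C) :
    ∫ w, g w * Sf U ρ h w * Wf U ρ w = cg n ρ * ∫ z, Tf ρ g z * h z * Real.exp (-U z) := by
  have h1 : ∀ w, g w * Sf U ρ h w * Wf U ρ w = ∫ z, g w * h z * Gf U ρ w z := by
    intro w
    have := (Wf_pos hU hUi ρ w).ne'
    simp only [mul_assoc]
    rw [integral_const_mul, Sf]
    field_simp
  have h2 : ∀ z, cg n ρ * (Tf ρ g z * h z * Real.exp (-U z)) = ∫ w, g w * h z * Gf U ρ w z := by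
    intro z
    have := (cg_pos (n := n) hρ).ne'
    have e : ∀ w, g w * h z * Gf U ρ w z = (h z * Real.exp (-U z)) * (g w * gm ρ (w - z)) := by
      intro w; rw [Gf_eq]; ring
    simp only [e]
    rw [integral_const_mul, Tf]
    field_simp
  rw [← integral_const_mul]
  simp only [h1, h2]
  apply integral_integral_swap
  refine (Gf_integrable_prod hUi hρ).bdd_mul (c := B * C) ?_ (ae_of_all _ fun p => ?_)
  · exact Continuous.aestronglyMeasurable (by fun_prop)
  · rw [norm_mul]
    exact mul_le_mul (hgB _) (hhB _) (norm_nonneg _) ((abs_nonneg _).trans (hgB p.1))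

theorem logconvex_decay {a : ℕ → ℝ} {q C : ℝ} (hq : 0 < q) (ha : ∀ k, 0 ≤ a k)
    (hlc : ∀ k, a (k + 1) ^ 2 ≤ a k * a (k + 2)) (hC : ∀ k, a (k + 1) ≤ C * q ^ k) (k : ℕ) :
    a k ≤ q ^ k * a 0 := by
  have step : ∀ k, a (k + 1) ≤ q * a k := by
    intro k
    by_contra hcon
    push Not at hcon
    have hk1 : 0 < a (k + 1) := lt_of_le_of_lt (mul_nonneg hq.le (ha k)) hcon
    have hk0 : 0 < a k := by
      rcases (ha k).lt_or_eq with h | h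
      · exact h
      · have := hlc k
        rw [← h] at this
        nlinarith
    set r := a (k + 1) / a k with hr
    have hrq : q < r := by rw [hr, lt_div_iff₀ hk0]; exact hcon
    have hr0 : 0 < r := hq.trans hrq
    have h1 : ∀ j, 0 < a (k + j) ∧ r * a (k + j) ≤ a (k + j + 1) := by
      intro j
      induction j with
      | zero => 
        refine ⟨hk0, le_of_eq ?_⟩
        rw [hr]; field_simp; simp
      | succ j ih =>
        obtain ⟨h1, h2⟩ := ih
        have h3 : 0 < a (k + j + 1) := lt_of_lt_of_le (by positivity) h2
        refine ⟨h3, ?_⟩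
        have h4 := hlc (k + j)
        have : a (k + j) * (r * a (k + j + 1)) ≤ a (k + j) * a (k + j + 2) := by nlinarith
        exact le_of_mul_le_mul_left this h1
    have h2 : ∀ j, r ^ j * a k ≤ a (k + j) := by
      intro j
      induction j with
      | zero => simp
      | succ j ih =>
        calc r ^ (j + 1) * a k = r * (r ^ j * a k) := by ring
          _ ≤ r * a (k + j) := mul_le_mul_of_nonneg_left ih hr0.le
          _ ≤ _ := (h1 j).2
    have h3 : ∀ j, (r / q) ^ j ≤ C * q ^ k / (r * a k) := by
      intro j
      rw [div_pow, div_le_div_iff₀ (by positivity) (by positivity)]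
      have e1 := h2 (j + 1)
      have e2 := hC (k + j)
      calc r ^ j * (r * a k) = r ^ (j + 1) * a k := by ring
        _ ≤ _ := e1.trans e2
        _ = _ := by ring
    have h4 := tendsto_pow_atTop_atTop_of_one_lt ((one_lt_div hq).2 hrq)
    obtain ⟨j, hj⟩ := (h4.eventually (Filter.eventually_gt_atTop (C * q ^ k / (r * a k)))).exists
    exact absurd (h3 j) (not_le.2 hj)
  induction k with
  | zero => simp
  | succ k ih =>
    calc a (k + 1) ≤ q * a k := step k
      _ ≤ q * (q ^ k * a 0) := mul_le_mul_of_nonneg_left ih hq.le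
      _ = _ := by ring

theorem cs_int {n : ℕ} {u v φ : EV n → ℝ} (hφ : ∀ x, 0 ≤ φ x)
    (huu : Integrable fun x => u x ^ 2 * φ x) (hvv : Integrable fun x => v x ^ 2 * φ x)
    (huv : Integrable fun x => u x * v x * φ x) :
    (∫ x, u x * v x * φ x) ^ 2 ≤ (∫ x, u x ^ 2 * φ x) * ∫ x, v x ^ 2 * φ x := by
  have key : ∀ t : ℝ, 0 ≤ (∫ x, v x ^ 2 * φ x) * (t * t) + (2 * ∫ x, u x * v x * φ x) * t 
      + ∫ x, u x ^ 2 * φ x := by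
    intro t
    have : ∫ x, (u x + t * v x) ^ 2 * φ x = (∫ x, v x ^ 2 * φ x) * (t * t) + 
        (2 * ∫ x, u x * v x * φ x) * t + ∫ x, u x ^ 2 * φ x := by
      have e : ∀ x, (u x + t * v x) ^ 2 * φ x = 
          (t * t) * (v x ^ 2 * φ x) + ((2 * t) * (u x * v x * φ x) + u x ^ 2 * φ x) := 
        fun x => by ring
      simp only [e]
      rw [integral_add (hvv.const_mul _) 
        (show Integrable fun x => (2 * t) * (u x * v x * φ x) + u x ^ 2 * φ x from 
          (huv.const_mul _).add huu), integral_add (huv.const_mul _) huu, integral_const_mul, 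
        integral_const_mul]
      ring
    rw [← this]
    exact integral_nonneg fun x => mul_nonneg (sq_nonneg _) (hφ x)
  have := discrim_le_zero key
  rw [discrim] at this
  linarith

theorem bdd_int {n : ℕ} {u φ : EV n → ℝ} {B : ℝ} (hu : Continuous u) (hB : ∀ x, |u x| ≤ B)
    (hφ : Integrable φ) : Integrable fun x => u x * φ x :=
  hφ.bdd_mul hu.aestronglyMeasurable (ae_of_all _ hB)

theorem bdd_mul_bd {n : ℕ} {u v : EV n → ℝ} {B C : ℝ} (hB : ∀ x, |u x| ≤ B) (hC : ∀ x, |v x| ≤ C) :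
    ∀ x, |u x * v x| ≤ B * C := fun x => by
  rw [abs_mul]
  exact mul_le_mul (hB _) (hC _) (abs_nonneg _) ((abs_nonneg _).trans (hB x))

theorem var_bound {n : ℕ} {U h : EV n → ℝ} {m L B : ℝ} (hU : Continuous U) (hm : 0 < m)
    (hUi : Integrable fun z => Real.exp (-U z))
    (hsc : ConvexOn ℝ Set.univ fun z => U z - m / 2 * ‖z‖ ^ 2)
    (hL : 0 < L) (hh : Nice L B h) (h0 : ∫ z, h z * Real.exp (-U z) = 0) :
    ∫ z, h z * h z * Real.exp (-U z) ≤ 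
      L ^ 2 * (4 * (Real.exp (1 / (2 * m)) * ∫ z, Real.exp (-U z))) := by
  have hhc := hh.cont
  have gen : ∀ s : ℝ, |s| = 1 → Integrable (fun z => Real.exp (s * (h z / L) - U z)) ∧ 
      ∫ z, Real.exp (s * (h z / L) - U z) ≤ Real.exp (1 / (2 * m)) * ∫ z, Real.exp (-U z) := by
    intro s hs
    have := conc (V := U) (g := fun z => s * (h z / L)) (L := 1) hU (by fun_prop) hm hsc
      (fun x y => by
        rw [← mul_sub, ← sub_div, abs_mul, hs, abs_div, abs_of_pos hL, one_mul, one_mul,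
          div_le_iff₀ hL, mul_comm]
        exact hh.lip x y) hUi 
      (bdd_int (B := B / L) (by fun_prop) (fun x => by
        rw [abs_mul, hs, one_mul, abs_div, abs_of_pos hL]
        exact div_le_div_of_nonneg_right (hh.bdd x) hL.le) hUi)
      (by
        have e : ∀ z, s * (h z / L) * Real.exp (-U z) = s / L * (h z * Real.exp (-U z)) := 
          fun z => by ring
        simp only [e]; rw [integral_const_mul, h0, mul_zero])
    simpa using this
  obtain ⟨i1, b1⟩ := gen 1 (by simp)
  obtain ⟨i2, b2⟩ := gen (-1) (by simp)
  calc ∫ z, h z * h z * Real.exp (-U z) 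
      ≤ ∫ z, L ^ 2 * (2 * (Real.exp (1 * (h z / L) - U z) + Real.exp (-1 * (h z / L) - U z))) := by
        refine integral_mono (bdd_int (by fun_prop) (bdd_mul_bd hh.bdd hh.bdd) hUi)
          (((i1.add i2).const_mul 2).const_mul (L ^ 2)) fun z => ?_
        dsimp only
        set x := h z / L with hx
        have hhx : h z = L * x := by rw [hx]; field_simp
        have e1 : x * x ≤ 2 * (Real.exp (1 * x) + Real.exp (-1 * x)) := by
          have f1 := Real.exp_pos (1 * x)
          have f2 := Real.exp_pos (-1 * x)
          rcases le_total 0 x with hx0 | hx0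
          · have := Real.quadratic_le_exp_of_nonneg (x := 1 * x) (by linarith)
            nlinarith
          · have := Real.quadratic_le_exp_of_nonneg (x := -1 * x) (by linarith)
            nlinarith
        rw [sub_eq_add_neg, sub_eq_add_neg, Real.exp_add, Real.exp_add, hhx]
        have := mul_le_mul_of_nonneg_right e1 (Real.exp_pos (-U z)).le
        have := mul_le_mul_of_nonneg_left this (sq_nonneg L)
        linarith
    _ = L ^ 2 * (2 * (∫ z, Real.exp (1 * (h z / L) - U z)) + 
          2 * ∫ z, Real.exp (-1 * (h z / L) - U z)) := by
        rw [integral_const_mul, integral_const_mul, integral_add i1 i2]; ring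
    _ ≤ _ := by
        refine mul_le_mul_of_nonneg_left ?_ (sq_nonneg L)
        linarith

def Pf {n : ℕ} (U : EV n → ℝ) (ρ : ℝ) (g : EV n → ℝ) : EV n → ℝ := Sf U ρ (Tf ρ g)

theorem Tf_one {n : ℕ} {ρ : ℝ} (hρ : 0 < ρ) : Tf (n := n) ρ (fun _ => 1) = fun _ => 1 := by
  ext z
  rw [Tf_alt]
  have := cg_pos (n := n) hρ
  simp only [one_mul]
  exact div_self this.ne'

theorem Sf_one {n : ℕ} {U : EV n → ℝ} {ρ : ℝ} (hU : Continuous U)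
    (hUi : Integrable fun z => Real.exp (-U z)) : Sf U ρ (fun _ => 1) = fun _ => 1 := by
  ext w
  have := Wf_pos hU hUi ρ w
  simp only [Sf, one_mul]
  exact div_self this.ne'

theorem T_mean {n : ℕ} {U g : EV n → ℝ} {ρ B : ℝ} (hU : Continuous U)
    (hUi : Integrable fun z => Real.exp (-U z)) (hρ : 0 < ρ)
    (hg : Continuous g) (hgB : ∀ x, |g x| ≤ B) :
    ∫ w, g w * Wf U ρ w = cg n ρ * ∫ z, Tf ρ g z * Real.exp (-U z) := by
  have := ST_adj (h := fun _ => 1) (C := 1) hU hUi hρ hg hgB continuous_const (by simp)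
  simpa [Sf_one hU hUi] using this

theorem S_mean {n : ℕ} {U h : EV n → ℝ} {ρ B : ℝ} (hU : Continuous U)
    (hUi : Integrable fun z => Real.exp (-U z)) (hρ : 0 < ρ)
    (hh : Continuous h) (hhB : ∀ x, |h x| ≤ B) :
    ∫ w, Sf U ρ h w * Wf U ρ w = cg n ρ * ∫ z, h z * Real.exp (-U z) := by
  have := ST_adj (g := fun _ => 1) (B := 1) hU hUi hρ continuous_const (by simp) hh hhB
  simpa [Tf_one hρ] using this

theorem Nice.iter {n : ℕ} {U g : EV n → ℝ} {m L B ρ : ℝ} (hU : Continuous U) (hm : 0 < m)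
    (hUi : Integrable fun z => Real.exp (-U z)) (hρ : 0 < ρ)
    (hsc : ConvexOn ℝ Set.univ fun z => U z - m / 2 * ‖z‖ ^ 2)
    (hL : 0 < L) (hg : Nice L B g) (k : ℕ) :
    Nice (L * (1 / (1 + m * ρ ^ 2)) ^ k) B ((Pf U ρ)^[k] g) := by
  induction k with
  | zero => simpa using hg
  | succ k ih =>
    rw [Function.iterate_succ_apply']
    have := (ih.T hρ).S hU hm hUi hρ hsc (by positivity)
    convert this using 1
    · rw [pow_succ]; ring
    · rfl

theorem P_mean {n : ℕ} {U g : EV n → ℝ} {m L B ρ : ℝ} (hU : Continuous U) (hm : 0 < m)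
    (hUi : Integrable fun z => Real.exp (-U z)) (hρ : 0 < ρ)
    (hsc : ConvexOn ℝ Set.univ fun z => U z - m / 2 * ‖z‖ ^ 2)
    (hL : 0 < L) (hg : Nice L B g) (k : ℕ) :
    ∫ w, ((Pf U ρ)^[k] g) w * Wf U ρ w = ∫ w, g w * Wf U ρ w := by
  induction k with
  | zero => rfl
  | succ k ih =>
    rw [Function.iterate_succ_apply', ← ih]
    have hk := hg.iter hU hm hUi hρ hsc hL k
    rw [T_mean hU hUi hρ hk.cont hk.bdd, Pf, S_mean hU hUi hρ (hk.T hρ).cont (hk.T hρ).bdd]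

theorem P_contr {n : ℕ} {U g : EV n → ℝ} {m L B ρ : ℝ} (hU : Continuous U) (hm : 0 < m)
    (hUi : Integrable fun z => Real.exp (-U z)) (hρ : 0 < ρ)
    (hsc : ConvexOn ℝ Set.univ fun z => U z - m / 2 * ‖z‖ ^ 2)
    (hL : 0 < L) (hg : Nice L B g) (h0 : ∫ w, g w * Wf U ρ w = 0) (t : ℕ) :
    ∫ w, ((Pf U ρ)^[t] g) w ^ 2 * Wf U ρ w ≤ 
      ((1 / (1 + m * ρ ^ 2)) ^ 2) ^ t * ∫ w, g w ^ 2 * Wf U ρ w := by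
  set κ := 1 / (1 + m * ρ ^ 2) with hκ
  have hκ0 : 0 < κ := by positivity
  have hκ1 : κ ≤ 1 := by
    rw [hκ, div_le_one (by positivity)]; nlinarith [sq_nonneg ρ, mul_nonneg hm.le (sq_nonneg ρ)]
  set G : ℕ → EV n → ℝ := fun k => (Pf U ρ)^[k] g with hG
  have hGs : ∀ k, G (k + 1) = Sf U ρ (Tf ρ (G k)) := fun k => by
    simp only [hG]; rw [Function.iterate_succ_apply']; rfl
  have nG : ∀ k, Nice (L * κ ^ k) B (G k) := fun k => hg.iter hU hm hUi hρ hsc hL k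
  have nT : ∀ k, Nice (L * κ ^ k) B (Tf ρ (G k)) := fun k => (nG k).T hρ
  have mG : ∀ k, ∫ w, G k w * Wf U ρ w = 0 := fun k => by
    rw [← h0]; exact P_mean hU hm hUi hρ hsc hL hg k
  have hc0 := cg_pos (n := n) hρ
  have mT : ∀ k, ∫ z, Tf ρ (G k) z * Real.exp (-U z) = 0 := fun k => by
    have := mG k
    rw [T_mean hU hUi hρ (nG k).cont (nG k).bdd] at this
    exact (mul_eq_zero.1 this).resolve_left hc0.ne'
  have hWi := Wf_integrable hUi hρ (U := U)
  have W0 : ∀ w, 0 ≤ Wf U ρ w := fun w => (Wf_pos hU hUi ρ w).le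
  have iGG : ∀ j k, Integrable fun w => G j w * G k w * Wf U ρ w := fun j k => by
    have c1 := (nG j).cont
    have c2 := (nG k).cont
    exact bdd_int (by fun_prop) (bdd_mul_bd (nG j).bdd (nG k).bdd) hWi
  have iTT : ∀ j k, Integrable fun z => Tf ρ (G j) z * Tf ρ (G k) z * Real.exp (-U z) := fun j k => by
    have c1 := (nT j).cont
    have c2 := (nT k).cont
    exact bdd_int (by fun_prop) (bdd_mul_bd (nT j).bdd (nT k).bdd) hUi
  have adj : ∀ j k, ∫ w, G j w * G (k + 1) w * Wf U ρ w = 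
      cg n ρ * ∫ z, Tf ρ (G j) z * Tf ρ (G k) z * Real.exp (-U z) := by
    intro j k
    rw [hGs k]
    exact ST_adj hU hUi hρ (nG j).cont (nG j).bdd (nT k).cont (nT k).bdd
  have vb : ∀ k, ∫ z, Tf ρ (G k) z * Tf ρ (G k) z * Real.exp (-U z) ≤ 
      (L * κ ^ k) ^ 2 * (4 * (Real.exp (1 / (2 * m)) * ∫ z, Real.exp (-U z))) := fun k =>
    var_bound hU hm hUi hsc (by positivity) (nT k) (mT k)
  set D := 4 * (Real.exp (1 / (2 * m)) * ∫ z, Real.exp (-U z)) with hD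
  have hD0 : 0 ≤ D := by
    have := integral_exp_pos hUi
    positivity
  have main := logconvex_decay (a := fun k => ∫ w, G k w ^ 2 * Wf U ρ w) (q := κ ^ 2) 
    (C := cg n ρ * (L ^ 2 * D)) (by positivity)
    (fun k => integral_nonneg fun w => mul_nonneg (sq_nonneg _) (W0 w)) ?_ ?_ t
  · exact main
  · intro k
    have e : ∫ w, G (k + 1) w ^ 2 * Wf U ρ w = ∫ w, G k w * G (k + 2) w * Wf U ρ w := by
      simp only [sq]
      rw [adj, adj]
      simp only [mul_comm (Tf ρ (G (k + 1)) _)]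
    rw [e]
    exact cs_int W0 (by simpa only [sq] using iGG k k) 
      (by simpa only [sq] using iGG (k + 2) (k + 2)) (iGG k (k + 2))
  · intro k
    simp only [sq (G _ _)]
    rw [adj, mul_assoc]
    refine mul_le_mul_of_nonneg_left ?_ hc0.le
    have h1 : ∫ z, Tf ρ (G (k + 1)) z * Tf ρ (G k) z * Real.exp (-U z) ≤ 
        ∫ z, (1 / 2) * (Tf ρ (G (k + 1)) z * Tf ρ (G (k + 1)) z * Real.exp (-U z) + 
          Tf ρ (G k) z * Tf ρ (G k) z * Real.exp (-U z)) := by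
      refine integral_mono (iTT _ _) (((iTT _ _).add (iTT _ _)).const_mul _) fun z => ?_
      dsimp only
      rw [← add_mul, ← mul_assoc]
      refine mul_le_mul_of_nonneg_right ?_ (Real.exp_pos _).le
      nlinarith [sq_nonneg (Tf ρ (G (k + 1)) z - Tf ρ (G k) z)]
    rw [integral_const_mul, integral_add (iTT _ _) (iTT _ _)] at h1
    have h2 := vb (k + 1)
    have h3 := vb k
    have h4 : (L * κ ^ (k + 1)) ^ 2 * D ≤ (L * κ ^ k) ^ 2 * D := by
      refine mul_le_mul_of_nonneg_right ?_ hD0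
      refine pow_le_pow_left₀ (by positivity) ?_ 2
      exact mul_le_mul_of_nonneg_left (pow_le_pow_of_le_one hκ0.le hκ1 (Nat.le_succ k)) hL.le
    have h5 : L ^ 2 * D * (κ ^ 2) ^ k = (L * κ ^ k) ^ 2 * D := by ring
    rw [h5]
    linarith

theorem taylor_upper {n : ℕ} {U : EV n → ℝ} {M : ℝ} (hC2 : ContDiff ℝ 2 U)
    (hHess : ∀ (z v : EV n), |⟪v, fderiv ℝ (gradient U) z v⟫| ≤ M * ‖v‖ ^ 2) (w v : EV n) :
    U (w + v) ≤ U w + ⟪gradient U w, v⟫ + M / 2 * ‖v‖ ^ 2 := by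
  have hd : Differentiable ℝ U := hC2.differentiable (by norm_num)
  have hg : Differentiable ℝ (gradient U) := by
    have h1 : Differentiable ℝ (fderiv ℝ U) :=
      (hC2.fderiv_right (m := 1) (by norm_num)).differentiable (by norm_num)
    exact ((InnerProductSpace.toDual ℝ (EV n)).symm.toContinuousLinearEquiv.differentiable).comp h1
  have hl : ∀ s : ℝ, HasDerivAt (fun s : ℝ => w + s • v) v s := fun s => by
    simpa using ((hasDerivAt_id s).smul_const v).const_add w
  have hφ : ∀ s : ℝ, HasDerivAt (fun s : ℝ => U (w + s • v)) ⟪gradient U (w + s • v), v⟫ s := by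
    intro s
    have h := (hd (w + s • v)).hasGradientAt.hasFDerivAt.comp_hasDerivAt s (hl s)
    exact h
  have hφ' : ∀ s : ℝ, HasDerivAt (fun s : ℝ => ⟪gradient U (w + s • v), v⟫)
      ⟪fderiv ℝ (gradient U) (w + s • v) v, v⟫ s := by
    intro s
    have h := ((hg (w + s • v)).hasFDerivAt.comp_hasDerivAt s (hl s)).inner ℝ (hasDerivAt_const s v)
    simpa using h
  have hA : Antitone fun s : ℝ => ⟪gradient U (w + s • v), v⟫ - M * ‖v‖ ^ 2 * s := by
    have hh : ∀ s, HasDerivAt (fun s : ℝ => ⟪gradient U (w + s • v), v⟫ - M * ‖v‖ ^ 2 * s)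
      (⟪fderiv ℝ (gradient U) (w + s • v) v, v⟫ - M * ‖v‖ ^ 2) s := fun s => by
        have h := (hφ' s).sub ((hasDerivAt_id s).const_mul (M * ‖v‖ ^ 2))
        exact h.congr_deriv (by rw [mul_one])
    refine antitone_of_deriv_nonpos (fun s => (hh s).differentiableAt) fun s => ?_
    rw [(hh s).deriv, real_inner_comm]
    linarith [le_abs_self (⟪v, fderiv ℝ (gradient U) (w + s • v) v⟫), hHess (w + s • v) v]
  have hh : ∀ s, HasDerivAt (fun s : ℝ => U (w + s • v) - ⟪gradient U w, v⟫ * s - M / 2 * ‖v‖ ^ 2 * s ^ 2)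
      (⟪gradient U (w + s • v), v⟫ - ⟪gradient U w, v⟫ - M * ‖v‖ ^ 2 * s) s := fun s => by
    have h := ((hφ s).sub ((hasDerivAt_id s).const_mul (⟪gradient U w, v⟫))).sub
      ((hasDerivAt_pow 2 s).const_mul (M / 2 * ‖v‖ ^ 2))
    refine h.congr_deriv ?_
    simp; ring
  have hB := antitoneOn_of_deriv_nonpos (convex_Icc (0:ℝ) 1)
    (fun s _ => (hh s).continuousAt.continuousWithinAt)
    (fun s _ => (hh s).differentiableAt.differentiableWithinAt) (fun s hs => by
      rw [interior_Icc] at hs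
      rw [(hh s).deriv]
      have := hA hs.1.le
      simp only [zero_smul, add_zero, mul_zero, sub_zero] at this
      linarith)
  have := hB (by simp : (0:ℝ) ∈ Set.Icc 0 1) (by simp : (1:ℝ) ∈ Set.Icc 0 1) zero_le_one
  simp only [zero_smul, one_smul, add_zero, mul_zero, sub_zero, mul_one, one_pow, ne_eq,
    OfNat.ofNat_ne_zero, not_false_eq_true, zero_pow] at this
  linarith

theorem U_upper {n : ℕ} {U : EV n → ℝ} {M : ℝ} (hC2 : ContDiff ℝ 2 U)
    (hHess : ∀ (z v : EV n), |⟪v, fderiv ℝ (gradient U) z v⟫| ≤ M * ‖v‖ ^ 2) {w₀ : EV n}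
    (hmin : ∀ w, U w₀ ≤ U w) (w : EV n) : U w ≤ U w₀ + M / 2 * ‖w - w₀‖ ^ 2 := by
  have h0 : gradient U w₀ = 0 := by
    have : IsLocalMin U w₀ := Filter.Eventually.of_forall hmin
    rw [gradient, this.fderiv_eq_zero, map_zero]
  have := taylor_upper hC2 hHess w₀ (w - w₀)
  simpa [h0] using this

theorem U_lower {n : ℕ} {U : EV n → ℝ} {m : ℝ}
    (hsc : ConvexOn ℝ Set.univ fun z => U z - m / 2 * ‖z‖ ^ 2) {w₀ : EV n}
    (hmin : ∀ w, U w₀ ≤ U w) (w : EV n) : U w₀ + m / 2 * ‖w - w₀‖ ^ 2 ≤ U w := by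
  have key : ∀ s : ℝ, 0 < s → s < 1 → m / 2 * (1 - s) * ‖w - w₀‖ ^ 2 ≤ U w - U w₀ := by
    intro s hs hs1
    have h := strong_conv hsc (a := s) (b := 1 - s) hs.le (by linarith) (by ring) w w₀
    have h2 := hmin (s • w + (1 - s) • w₀)
    have : s * (m / 2 * (1 - s) * ‖w - w₀‖ ^ 2) ≤ s * (U w - U w₀) := by nlinarith
    exact le_of_mul_le_mul_left this hs
  have ht : Filter.Tendsto (fun s : ℝ => m / 2 * (1 - s) * ‖w - w₀‖ ^ 2) (nhdsWithin 0 (Set.Ioi 0))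
      (nhds (m / 2 * (1 - 0) * ‖w - w₀‖ ^ 2)) := by
    apply Filter.Tendsto.mono_left _ nhdsWithin_le_nhds
    apply Continuous.tendsto; fun_prop
  have := le_of_tendsto ht (by
    filter_upwards [Ioo_mem_nhdsGT (zero_lt_one : (0:ℝ) < 1)] with s hs using key s hs.1 hs.2)
  linarith

theorem gauss_val {n : ℕ} {b : ℝ} (hb : 0 < b) :
    ∫ v : EV n, Real.exp (-b * ‖v‖ ^ 2) = (Real.pi / b) ^ ((n : ℝ) / 2) := by
  rw [GaussianFourier.integral_rexp_neg_mul_sq_norm hb]; simp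

theorem cg_val {n : ℕ} {ρ : ℝ} (hρ : 0 < ρ) : cg n ρ = (2 * Real.pi * ρ ^ 2) ^ ((n : ℝ) / 2) := by
  have := gauss_val (n := n) (b := 1 / (2 * ρ ^ 2)) (by positivity)
  rw [cg]
  convert this using 2
  · ext v; simp only [gm]; congr 1; ring
  · field_simp

theorem W_low {n : ℕ} {U : EV n → ℝ} {M ρ : ℝ} (hC2 : ContDiff ℝ 2 U) (hM : 0 < M) (hρ : 0 < ρ)
    (hUi : Integrable fun z => Real.exp (-U z))
    (hHess : ∀ (z v : EV n), |⟪v, fderiv ℝ (gradient U) z v⟫| ≤ M * ‖v‖ ^ 2) (w : EV n) :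
    Real.exp (-U w) * (cg n ρ * Real.exp (-(M * ρ ^ 2 * n / 2))) ≤ Wf U ρ w := by
  have hU := hC2.continuous
  set b := (1 + M * ρ ^ 2) / (2 * ρ ^ 2) with hb
  have hb0 : 0 < b := by positivity
  have hG := Gf_integrable hU hUi ρ w
  have e1 : Wf U ρ w = ∫ v, Gf U ρ w (w + v) := (integral_add_left_eq_self (Gf U ρ w) w).symm
  have e2 : Wf U ρ w = ∫ v, Gf U ρ w (w - v) := (integral_sub_left_eq_self (Gf U ρ w) volume w).symm
  have i1 : Integrable fun v => Gf U ρ w (w + v) := hG.comp_add_left w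
  have i2 : Integrable fun v => Gf U ρ w (w - v) := hG.comp_sub_left w
  have e3 : 2 * Wf U ρ w = ∫ v, (Gf U ρ w (w + v) + Gf U ρ w (w - v)) := by
    rw [integral_add i1 i2, ← e1, ← e2]; ring
  have e4 : 2 * (Real.exp (-U w) * ∫ v : EV n, Real.exp (-b * ‖v‖ ^ 2)) ≤ 2 * Wf U ρ w := by
    rw [e3, ← integral_const_mul, ← integral_const_mul]
    refine integral_mono (((gauss_integrable hb0).const_mul _).const_mul _) (i1.add i2) fun v => ?_
    have t1 := taylor_upper hC2 hHess w v
    have t2 := taylor_upper hC2 hHess w (-v)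
    simp only [inner_neg_right, norm_neg, ← sub_eq_add_neg] at t2
    simp only [Gf, add_sub_cancel_left, sub_sub_cancel_left, norm_neg]
    set x := -U (w + v) - ‖v‖ ^ 2 / (2 * ρ ^ 2)
    set y := -U (w - v) - ‖v‖ ^ 2 / (2 * ρ ^ 2)
    have h1 : 2 * Real.exp ((x + y) / 2) ≤ Real.exp x + Real.exp y := by
      have ex : Real.exp x = Real.exp (x / 2) ^ 2 := by rw [sq, ← Real.exp_add]; congr 1; ring
      have ey : Real.exp y = Real.exp (y / 2) ^ 2 := by rw [sq, ← Real.exp_add]; congr 1; ring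
      rw [add_div, Real.exp_add, ex, ey]
      nlinarith [sq_nonneg (Real.exp (x / 2) - Real.exp (y / 2))]
    refine le_trans ?_ h1
    rw [← Real.exp_add]
    gcongr
    have : -b * ‖v‖ ^ 2 = - (M / 2 * ‖v‖ ^ 2) - ‖v‖ ^ 2 / (2 * ρ ^ 2) := by
      rw [hb]; field_simp; ring
    rw [this]
    simp only [x, y]
    linarith
  have e5 : cg n ρ * Real.exp (-(M * ρ ^ 2 * n / 2)) ≤ ∫ v : EV n, Real.exp (-b * ‖v‖ ^ 2) := by
    rw [gauss_val hb0, cg_val hρ]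
    have : Real.exp (-(M * ρ ^ 2 * n / 2)) = (Real.exp (-(M * ρ ^ 2))) ^ ((n : ℝ) / 2) := by
      rw [← Real.exp_mul]; congr 1; ring
    rw [this, ← Real.mul_rpow (by positivity) (by positivity)]
    refine Real.rpow_le_rpow (by positivity) ?_ (by positivity)
    have hx := Real.add_one_le_exp (M * ρ ^ 2)
    rw [Real.exp_neg, hb, ← div_eq_mul_inv]
    have : Real.pi / ((1 + M * ρ ^ 2) / (2 * ρ ^ 2)) = 2 * Real.pi * ρ ^ 2 / (1 + M * ρ ^ 2) := by
      field_simp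
    rw [this]
    gcongr
    linarith
  have := mul_le_mul_of_nonneg_left e5 (Real.exp_pos (-U w)).le
  linarith

theorem W_total {n : ℕ} {U : EV n → ℝ} {ρ : ℝ} (hU : Continuous U)
    (hUi : Integrable fun z => Real.exp (-U z)) (hρ : 0 < ρ) :
    ∫ w, Wf U ρ w = cg n ρ * ∫ z, Real.exp (-U z) := by
  have := T_mean (g := fun _ => 1) (B := 1) hU hUi hρ continuous_const (by simp)
  rw [Tf_one hρ] at this
  simpa using this

theorem Z_upper {n : ℕ} {U : EV n → ℝ} {m : ℝ} (hm : 0 < m)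
    (hUi : Integrable fun z => Real.exp (-U z))
    (hsc : ConvexOn ℝ Set.univ fun z => U z - m / 2 * ‖z‖ ^ 2) {w₀ : EV n}
    (hmin : ∀ w, U w₀ ≤ U w) :
    ∫ z, Real.exp (-U z) ≤ Real.exp (-U w₀) * (2 * Real.pi / m) ^ ((n : ℝ) / 2) := by
  have h := gauss_val (n := n) (b := m / 2) (by positivity)
  have e : Real.pi / (m / 2) = 2 * Real.pi / m := by field_simp
  rw [e] at h
  rw [← h, ← integral_sub_right_eq_self (fun v : EV n => Real.exp (-(m / 2) * ‖v‖ ^ 2)) w₀, ← integral_const_mul]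
  refine integral_mono hUi (((gauss_integrable (by positivity)).comp_sub_right w₀).const_mul _) fun z => ?_
  simp only []
  rw [← Real.exp_add]
  gcongr
  linarith [U_lower hsc hmin z]

/-- initial (unnormalized) density in the transformed space -/
def N0 {n : ℕ} (M : ℝ) (w₀ w : EV n) : ℝ := Real.exp (-(M / 2 * ‖w - w₀‖ ^ 2))

theorem N0_integrable {n : ℕ} {M : ℝ} (hM : 0 < M) (w₀ : EV n) : Integrable (N0 M w₀) := by
  have := (gauss_integrable (n := n) (b := M / 2) (by positivity)).comp_sub_right w₀
  simp only [neg_mul] at this; exact this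

theorem N0_val {n : ℕ} {M : ℝ} (hM : 0 < M) (w₀ : EV n) :
    ∫ w, N0 M w₀ w = (2 * Real.pi / M) ^ ((n : ℝ) / 2) := by
  have h := gauss_val (n := n) (b := M / 2) (by positivity)
  have e : Real.pi / (M / 2) = 2 * Real.pi / M := by field_simp
  rw [e] at h
  rw [← h, ← integral_sub_right_eq_self (fun v : EV n => Real.exp (-(M / 2) * ‖v‖ ^ 2)) w₀]
  simp only [N0, neg_mul]

theorem N0_W {n : ℕ} {U : EV n → ℝ} {M ρ : ℝ} (hC2 : ContDiff ℝ 2 U) (hM : 0 < M) (hρ : 0 < ρ)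
    (hUi : Integrable fun z => Real.exp (-U z))
    (hHess : ∀ (z v : EV n), |⟪v, fderiv ℝ (gradient U) z v⟫| ≤ M * ‖v‖ ^ 2) {w₀ : EV n}
    (hmin : ∀ w, U w₀ ≤ U w) (w : EV n) :
    N0 M w₀ w ≤ Real.exp (U w₀) * Real.exp (M * ρ ^ 2 * n / 2) / cg n ρ * Wf U ρ w := by
  have h1 := W_low hC2 hM hρ hUi hHess w
  have h2 := U_upper hC2 hHess hmin w
  have hc := cg_pos (n := n) hρ
  have h3 : N0 M w₀ w ≤ Real.exp (U w₀) * Real.exp (- U w) := by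
    rw [N0, ← Real.exp_add]; gcongr; linarith
  refine h3.trans ?_
  calc Real.exp (U w₀) * Real.exp (- U w) = Real.exp (U w₀) * Real.exp (M * ρ ^ 2 * n / 2) / cg n ρ *
      (Real.exp (-U w) * (cg n ρ * Real.exp (-(M * ρ ^ 2 * n / 2)))) := by
        rw [Real.exp_neg (M * ρ ^ 2 * n / 2)]; field_simp
    _ ≤ _ := by gcongr

theorem Nice.sub_const {n : ℕ} {L B : ℝ} {g : EV n → ℝ} (hg : Nice L B g) (c : ℝ) :
    Nice L (B + |c|) (fun x => g x - c) where
  cont := hg.cont.sub continuous_const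
  bdd := fun x => (abs_sub _ _).trans (by linarith [hg.bdd x])
  lip := fun x y => by simpa using hg.lip x y

theorem Pf_sub_const {n : ℕ} {U g : EV n → ℝ} {L B ρ : ℝ} (hU : Continuous U)
    (hUi : Integrable fun z => Real.exp (-U z)) (hρ : 0 < ρ)
    (hg : Nice L B g) (c : ℝ) :
    Pf U ρ (fun x => g x - c) = fun x => Pf U ρ g x - c := by
  have h1 : Tf ρ (fun x => g x - c) = fun x => Tf ρ g x - c := by
    ext z
    have i1 := bdd_int hg.cont hg.bdd (gm_shift_integrable hρ z)
    have i2 := (gm_shift_integrable hρ z).const_mul c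
    have h0 := congrFun (Tf_one (n := n) hρ) z
    simp only [Tf, one_mul] at h0 ⊢
    simp_rw [sub_mul]
    rw [integral_sub i1 i2, integral_const_mul, sub_div, mul_div_assoc, h0, mul_one]
  ext w
  have hT := hg.T hρ
  have i1 := bdd_int hT.cont hT.bdd (Gf_integrable hU hUi ρ w)
  have i2 := (Gf_integrable hU hUi ρ w).const_mul c
  have h0 := congrFun (Sf_one (ρ := ρ) hU hUi) w
  simp only [Pf, h1]
  simp only [Sf, one_mul] at h0 ⊢
  simp_rw [sub_mul]
  rw [integral_sub i1 i2, integral_const_mul, sub_div, mul_div_assoc, h0, mul_one]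

theorem Pf_iter_sub_const {n : ℕ} {U g : EV n → ℝ} {m L B ρ : ℝ} (hU : Continuous U) (hm : 0 < m)
    (hUi : Integrable fun z => Real.exp (-U z)) (hρ : 0 < ρ)
    (hsc : ConvexOn ℝ Set.univ fun z => U z - m / 2 * ‖z‖ ^ 2)
    (hL : 0 < L) (hg : Nice L B g) (c : ℝ) (t : ℕ) :
    (Pf U ρ)^[t] (fun x => g x - c) = fun x => (Pf U ρ)^[t] g x - c := by
  induction t with
  | zero => rfl
  | succ k ih =>
    rw [Function.iterate_succ_apply', ih, Pf_sub_const hU hUi hρ (hg.iter hU hm hUi hρ hsc hL k),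
      Function.iterate_succ_apply']

theorem conv_test {n : ℕ} {U g : EV n → ℝ} {m M L ρ : ℝ} (hC2 : ContDiff ℝ 2 U) (hm : 0 < m)
    (hM : 0 < M) (hUi : Integrable fun z => Real.exp (-U z)) (hρ : 0 < ρ)
    (hHess : ∀ (z v : EV n), |⟪v, fderiv ℝ (gradient U) z v⟫| ≤ M * ‖v‖ ^ 2)
    (hsc : ConvexOn ℝ Set.univ fun z => U z - m / 2 * ‖z‖ ^ 2)
    {w₀ : EV n} (hmin : ∀ w, U w₀ ≤ U w)
    (hL : 0 < L) (hg : Nice L 1 g) (hg0 : ∀ x, 0 ≤ g x) (t : ℕ) :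
    |(∫ w, (Pf U ρ)^[t] g w * N0 M w₀ w) / (∫ w, N0 M w₀ w) -
      (∫ w, g w * Wf U ρ w) / ∫ w, Wf U ρ w| ≤
    (1 / (1 + m * ρ ^ 2)) ^ t * Real.exp ((M * ρ ^ 2 * n / 2 + n / 2 * Real.log (M / m)) / 2) := by
  have hU := hC2.continuous
  have hWi := Wf_integrable hUi hρ
  have hWp := Wf_pos hU hUi ρ
  have hN := N0_integrable hM w₀
  have hNp : ∀ w, 0 < N0 M w₀ w := fun w => Real.exp_pos _
  have hNv := N0_val hM w₀
  have hNI : 0 < ∫ w, N0 M w₀ w := by rw [hNv]; positivity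
  have hcg := cg_pos (n := n) hρ
  have hWI : 0 < ∫ w, Wf U ρ w := by
    rw [W_total hU hUi hρ]
    exact mul_pos hcg (integral_exp_pos hUi)
  set c := (∫ w, g w * Wf U ρ w) / ∫ w, Wf U ρ w with hc
  have hgW := bdd_int hg.cont hg.bdd hWi
  have hc0 : 0 ≤ c := div_nonneg (integral_nonneg fun w => mul_nonneg (hg0 w) (hWp w).le) hWI.le
  have hc1 : c ≤ 1 := by
    rw [hc, div_le_one hWI]
    refine integral_mono hgW hWi fun w => ?_
    have := hg.bdd w
    rw [abs_of_nonneg (hg0 w)] at this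
    simpa using mul_le_mul_of_nonneg_right this (hWp w).le
  have hgc := hg.sub_const c
  have hmean : ∫ w, (g w - c) * Wf U ρ w = 0 := by
    simp_rw [sub_mul]
    rw [integral_sub hgW (hWi.const_mul c), integral_const_mul, hc]
    field_simp; simp
  have hcon := P_contr hU hm hUi hρ hsc hL hgc hmean t
  have hu := hgc.iter hU hm hUi hρ hsc hL t
  have hit := Pf_iter_sub_const hU hm hUi hρ hsc hL hg c t
  set u := (Pf U ρ)^[t] (fun x => g x - c) with hu_def
  set K := Real.exp (U w₀) * Real.exp (M * ρ ^ 2 * n / 2) / cg n ρ with hK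
  have hNW : ∀ w, N0 M w₀ w ≤ K * Wf U ρ w := N0_W hC2 hM hρ hUi hHess hmin
  have hPg := hg.iter hU hm hUi hρ hsc hL t
  have e1 : ∫ w, u w * N0 M w₀ w = (∫ w, (Pf U ρ)^[t] g w * N0 M w₀ w) - c * ∫ w, N0 M w₀ w := by
    rw [hit]
    simp_rw [sub_mul]
    rw [integral_sub (bdd_int hPg.cont hPg.bdd hN) (hN.const_mul c), integral_const_mul]
  have e2 : (∫ w, (Pf U ρ)^[t] g w * N0 M w₀ w) / (∫ w, N0 M w₀ w) - c =
      (∫ w, u w * N0 M w₀ w) / ∫ w, N0 M w₀ w := by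
    rw [e1]; field_simp
  rw [e2]
  have e3 : ∀ w, u w * N0 M w₀ w = u w * (N0 M w₀ w / Wf U ρ w) * Wf U ρ w := fun w => by
    have := (hWp w).ne'
    field_simp
  have hsq : ∀ w, (N0 M w₀ w / Wf U ρ w) ^ 2 * Wf U ρ w ≤ K * N0 M w₀ w := fun w => by
    have h1 := (hWp w)
    have : (N0 M w₀ w / Wf U ρ w) ^ 2 * Wf U ρ w = N0 M w₀ w * N0 M w₀ w / Wf U ρ w := by field_simp
    rw [this, div_le_iff₀ h1]
    nlinarith [hNW w, hNp w]
  have ivv : Integrable fun w => (N0 M w₀ w / Wf U ρ w) ^ 2 * Wf U ρ w := by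
    refine (hN.const_mul K).mono' ?_ (ae_of_all _ fun w => ?_)
    · exact ((hN.aestronglyMeasurable.aemeasurable.div hWi.aestronglyMeasurable.aemeasurable).pow_const 2
        |>.mul hWi.aestronglyMeasurable.aemeasurable).aestronglyMeasurable
    · rw [Real.norm_eq_abs, abs_of_nonneg (by have := (hWp w).le; positivity)]
      exact hsq w
  have iuu : Integrable fun w => u w ^ 2 * Wf U ρ w := by
    have := bdd_int (hu.cont.mul hu.cont) (bdd_mul_bd hu.bdd hu.bdd) hWi
    simpa only [sq, Pi.mul_apply] using this
  have iuv : Integrable fun w => u w * (N0 M w₀ w / Wf U ρ w) * Wf U ρ w := by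
    simp_rw [← e3]
    exact bdd_int hu.cont hu.bdd hN
  have hcs := cs_int (fun w => (hWp w).le) iuu ivv iuv
  simp_rw [← e3] at hcs
  have hv : ∫ w, (N0 M w₀ w / Wf U ρ w) ^ 2 * Wf U ρ w ≤ K * ∫ w, N0 M w₀ w := by
    rw [← integral_const_mul]
    exact integral_mono ivv (hN.const_mul K) hsq
  have hg2 : ∫ w, (g w - c) ^ 2 * Wf U ρ w ≤ cg n ρ * (Real.exp (-U w₀) * (2 * Real.pi / m) ^ ((n : ℝ) / 2)) := by
    calc ∫ w, (g w - c) ^ 2 * Wf U ρ w ≤ ∫ w, Wf U ρ w := by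
          refine integral_mono ?_ hWi fun w => ?_
          · have := bdd_int (hgc.cont.mul hgc.cont) (bdd_mul_bd hgc.bdd hgc.bdd) hWi
            simpa only [sq, Pi.mul_apply] using this
          · have h1 := hg.bdd w
            rw [abs_of_nonneg (hg0 w)] at h1
            have h2 := hg0 w
            have : (g w - c) ^ 2 ≤ 1 := by
              rw [sq_le_one_iff_abs_le_one, abs_le]; constructor <;> linarith
            simpa using mul_le_mul_of_nonneg_right this (hWp w).le
      _ = cg n ρ * ∫ z, Real.exp (-U z) := W_total hU hUi hρ
      _ ≤ _ := by gcongr; exact Z_upper hm hUi hsc hmin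
  set κ := 1 / (1 + m * ρ ^ 2) with hκ
  have hκ0 : 0 < κ := by positivity
  have hfin : (∫ w, u w * N0 M w₀ w) ^ 2 ≤
      (κ ^ 2) ^ t * (cg n ρ * (Real.exp (-U w₀) * (2 * Real.pi / m) ^ ((n : ℝ) / 2))) * (K * ∫ w, N0 M w₀ w) := by
    refine hcs.trans (mul_le_mul (hcon.trans (by gcongr)) hv ?_ (by positivity))
    exact integral_nonneg fun w => mul_nonneg (sq_nonneg _) (hWp w).le
  refine abs_le_of_sq_le_sq ?_ (by positivity)
  rw [div_pow, div_le_iff₀ (by positivity)]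
  refine hfin.trans (le_of_eq ?_)
  have hr : (2 * Real.pi / m) ^ ((n : ℝ) / 2) = (2 * Real.pi / M) ^ ((n : ℝ) / 2) * Real.exp (n / 2 * Real.log (M / m)) := by
    have : Real.exp (n / 2 * Real.log (M / m)) = (M / m) ^ ((n : ℝ) / 2) := by
      rw [Real.rpow_def_of_pos (by positivity)]; congr 1; ring
    rw [this, ← Real.mul_rpow (by positivity) (by positivity)]
    congr 1; field_simp
  rw [hr, ← hNv, mul_pow, ← Real.exp_nat_mul, hK, Real.exp_neg]
  have : Real.exp (((2:ℕ):ℝ) * ((M * ρ ^ 2 * n / 2 + n / 2 * Real.log (M / m)) / 2)) =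
    Real.exp (M * ρ ^ 2 * n / 2) * Real.exp (n / 2 * Real.log (M / m)) := by
    rw [← Real.exp_add]; congr 1; push_cast; ring
  rw [this, ← pow_mul, ← pow_mul, mul_comm t 2]
  field_simp

theorem numerics {d : ℕ} (hd : 0 < d) {m M ε ρ : ℝ} (hm : 0 < m) (hM : 0 < M)
    (hε0 : 0 < ε) (hε1 : ε ≤ 1) (hρpos : 0 < ρ) (hρ : M * ρ ^ 2 * d ≤ ε) (t : ℕ)
    (ht : (Real.log (2 / ε) + (5 * d / 8 + d / 2 * Real.log (M / m)) / 2) /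
        (m * ρ ^ 2 / (1 + m * ρ ^ 2)) ≤ t) :
    (1 / (1 + m * ρ ^ 2)) ^ t * Real.exp ((M * ρ ^ 2 * d / 2 + d / 2 * Real.log (M / m)) / 2) ≤ ε / 2 := by
  have hd1 : (1:ℝ) ≤ d := by exact_mod_cast hd
  set K := m * ρ ^ 2 / (1 + m * ρ ^ 2) with hK
  have hK0 : 0 < K := by positivity
  have hκ : 1 / (1 + m * ρ ^ 2) ≤ Real.exp (-K) := by
    have : 1 / (1 + m * ρ ^ 2) = -K + 1 := by rw [hK]; field_simp; ring
    rw [this]; exact Real.add_one_le_exp _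
  have h1 : (1 / (1 + m * ρ ^ 2)) ^ t ≤ Real.exp (-(K * t)) := by
    calc _ ≤ (Real.exp (-K)) ^ t := by gcongr
      _ = _ := by rw [← Real.exp_nat_mul]; congr 1; ring
  rw [div_le_iff₀ hK0] at ht
  have e : ε / 2 = Real.exp (-Real.log (2 / ε)) := by
    rw [Real.exp_neg, Real.exp_log (by positivity), inv_div]
  rw [e]
  calc _ ≤ Real.exp (-(K * t)) * Real.exp ((M * ρ ^ 2 * d / 2 + d / 2 * Real.log (M / m)) / 2) := by gcongr
    _ = Real.exp (-(K * t) + (M * ρ ^ 2 * d / 2 + d / 2 * Real.log (M / m)) / 2) := (Real.exp_add _ _).symm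
    _ ≤ _ := by
      gcongr
      linarith

theorem dens_norm {n : ℕ} {f : EV n → ℝ} (hi : Integrable f) (h0 : ∀ x, 0 ≤ f x) :
    (∫⁻ x, ENNReal.ofReal (f x)) = ENNReal.ofReal (∫ x, f x) :=
  (ofReal_integral_eq_lintegral_ofReal hi (ae_of_all _ h0)).symm

theorem dens_prob {n : ℕ} {f : EV n → ℝ} (hi : Integrable f) (h0 : ∀ x, 0 ≤ f x)
    (hp : 0 < ∫ x, f x) : IsProbabilityMeasure (densMeasure f) := by
  constructor
  rw [densMeasure, Measure.smul_apply, withDensity_apply _ MeasurableSet.univ, Measure.restrict_univ,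
    dens_norm hi h0, smul_eq_mul]
  exact ENNReal.inv_mul_cancel (by simpa using hp) ENNReal.ofReal_ne_top

theorem dens_int {n : ℕ} {f : EV n → ℝ} (hf : Measurable f) (hi : Integrable f) (h0 : ∀ x, 0 ≤ f x)
    (hp : 0 < ∫ x, f x) (g : EV n → ℝ) :
    ∫ x, g x ∂(densMeasure f) = (∫ x, g x * f x) / ∫ x, f x := by
  rw [densMeasure, integral_smul_measure, integral_withDensity_eq_integral_toReal_smul hf.ennreal_ofReal
    (ae_of_all _ fun x => ENNReal.ofReal_lt_top), dens_norm hi h0, ENNReal.toReal_inv,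
    ENNReal.toReal_ofReal hp.le, smul_eq_mul, div_eq_inv_mul]
  congr 2
  ext x
  rw [ENNReal.toReal_ofReal (h0 x), smul_eq_mul, mul_comm]

theorem dens_apply {n : ℕ} {f : EV n → ℝ} (hf : Measurable f) (hi : Integrable f) (h0 : ∀ x, 0 ≤ f x)
    (hp : 0 < ∫ x, f x) {s : Set (EV n)} (hs : MeasurableSet s) :
    (densMeasure f).real s = (∫ x in s, f x) / ∫ x, f x := by
  have := dens_int hf hi h0 hp (s.indicator 1)
  rw [integral_indicator_one hs] at this
  rw [this, ← integral_indicator hs]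
  congr 2
  ext x
  by_cases hx : x ∈ s <;> simp [hx]

theorem dens_meas {n : ℕ} {F : EV n → EV n → ℝ} (hF : Measurable (Function.uncurry F)) :
    Measurable fun θ => densMeasure (F θ) := by
  refine Measure.measurable_of_measurable_coe _ fun s hs => ?_
  simp only [densMeasure, Measure.smul_apply, withDensity_apply _ hs, smul_eq_mul]
  have h1 : Measurable fun p : EV n × EV n => ENNReal.ofReal (F p.1 p.2) := hF.ennreal_ofReal
  exact (h1.lintegral_prod_right' (ν := volume)).inv.mul (h1.lintegral_prod_right' (ν := volume.restrict s))

theorem bind_int {n : ℕ} {μ : Measure (EV n)} [IsProbabilityMeasure μ] {P : EV n → Measure (EV n)}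
    (hP : Measurable P) (hPp : ∀ x, IsProbabilityMeasure (P x)) {g : EV n → ℝ} {B : ℝ}
    (hg : Continuous g) (hB : ∀ x, |g x| ≤ B) :
    ∫ x, g x ∂(μ.bind P) = ∫ x, ∫ y, g y ∂(P x) ∂μ := by
  let η : ProbabilityTheory.Kernel (EV n) (EV n) := ⟨P, hP⟩
  have : ProbabilityTheory.IsMarkovKernel η := ⟨hPp⟩
  have h := ProbabilityTheory.Kernel.integral_comp (η := η) (κ := ProbabilityTheory.Kernel.const Unit μ) (a := ())
    (f := g) (Integrable.of_bound hg.aestronglyMeasurable B (ae_of_all _ hB))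
  rw [ProbabilityTheory.Kernel.comp_apply] at h
  exact h

theorem bind_prob {n : ℕ} {μ : Measure (EV n)} [IsProbabilityMeasure μ] {P : EV n → Measure (EV n)}
    (hP : Measurable P) (hPp : ∀ x, IsProbabilityMeasure (P x)) : IsProbabilityMeasure (μ.bind P) := by
  constructor
  rw [Measure.bind_apply MeasurableSet.univ hP.aemeasurable]
  simp

theorem tv_of_test {n : ℕ} {μ ν : Measure (EV n)} [IsProbabilityMeasure μ] [IsProbabilityMeasure ν]
    {δ : ℝ} (h : ∀ (L : ℝ) (g : EV n → ℝ), 0 < L → Nice L 1 g → (∀ x, 0 ≤ g x) →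
      ∫ x, g x ∂μ ≤ ∫ x, g x ∂ν + δ) {s : Set (EV n)} (hs : MeasurableSet s) :
    μ.real s ≤ ν.real s + δ := by
  have hclosed : ∀ F : Set (EV n), IsClosed F → μ.real F ≤ ν.real F + δ := by
    intro F hF
    have hδ : ∀ k : ℕ, (0:ℝ) < 1 / ((k:ℝ) + 1) := fun k => by positivity
    let g : ℕ → EV n → ℝ := fun k x => ((thickenedIndicator (hδ k) F x : NNReal) : ℝ)
    have hgc : ∀ k, Continuous (g k) := fun k =>
      NNReal.continuous_coe.comp (thickenedIndicator (hδ k) F).continuous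
    have hg0 : ∀ k x, 0 ≤ g k x := fun k x => NNReal.coe_nonneg _
    have hg1 : ∀ k x, g k x ≤ 1 := fun k x => by
      exact NNReal.coe_le_coe.2 (thickenedIndicator_le_one (hδ k) F x)
    have hgb : ∀ k x, |g k x| ≤ 1 := fun k x => by rw [abs_of_nonneg (hg0 k x)]; exact hg1 k x
    have hnice : ∀ k : ℕ, Nice (1 / ((k:ℝ) + 1))⁻¹ 1 (g k) := fun k => by
      refine ⟨hgc k, hgb k, fun x y => ?_⟩
      have := (lipschitzWith_thickenedIndicator (hδ k) F).dist_le_mul x y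
      rw [NNReal.dist_eq, dist_eq_norm] at this
      refine this.trans (le_of_eq ?_)
      congr 1
      rw [NNReal.coe_inv, Real.coe_toNNReal _ (hδ k).le]
    have hle : ∀ k, μ.real F ≤ ∫ x, g k x ∂ν + δ := fun k => by
      refine le_trans ?_ (h _ (g k) (inv_pos.2 (hδ k)) (hnice k) (hg0 k))
      rw [← integral_indicator_one hF.measurableSet]
      refine integral_mono ((integrable_const (1:ℝ)).indicator hF.measurableSet)
        (Integrable.of_bound (hgc k).aestronglyMeasurable 1 (ae_of_all _ (hgb k))) fun x => ?_
      by_cases hx : x ∈ F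
      · have := thickenedIndicator_one (hδ k) F hx
        simp only [g]
        rw [this]; simp [hx]
      · simp [hx, hg0]
    have hlim : Filter.Tendsto (fun k => ∫ x, g k x ∂ν) Filter.atTop (nhds (ν.real F)) := by
      rw [← integral_indicator_one hF.measurableSet]
      refine tendsto_integral_of_dominated_convergence (fun _ => 1)
        (fun k => (hgc k).aestronglyMeasurable) (integrable_const _)
        (fun k => ae_of_all _ (hgb k)) (ae_of_all _ fun x => ?_)
      have ht := thickenedIndicator_tendsto_indicator_closure hδ tendsto_one_div_add_atTop_nhds_zero_nat F
      rw [tendsto_pi_nhds] at ht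
      have := (NNReal.continuous_coe.tendsto _).comp (ht x)
      rw [hF.closure_eq] at this
      have e : F.indicator (1 : EV n → ℝ) x = ((F.indicator (fun _ => (1 : NNReal)) x : NNReal) : ℝ) := by
        by_cases hx : x ∈ F <;> simp [hx]
      rw [e]
      exact this
    exact ge_of_tendsto' (hlim.add_const δ) hle
  refine le_of_forall_pos_le_add fun η hη => ?_
  obtain ⟨F, hFs, hF, hlt⟩ := hs.exists_isClosed_sdiff_lt (μ := μ) (measure_ne_top μ s)
    (ε := ENNReal.ofReal η) (by simpa using hη)
  have h1 : μ.real s = μ.real F + μ.real (s \ F) := by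
    rw [measureReal_sdiff hFs hF.measurableSet]; ring
  have h2 : μ.real (s \ F) ≤ η := by
    rw [Measure.real]
    exact ENNReal.toReal_le_of_le_ofReal hη.le hlt.le
  have h3 : ν.real F ≤ ν.real s := measureReal_mono hFs
  linarith [hclosed F hF]

/-- the kernel in the transformed space -/
def Pw {n : ℕ} (U : EV n → ℝ) (ρ : ℝ) (w : EV n) : Measure (EV n) :=
  (densMeasure (Gf U ρ w)).bind fun z => densMeasure fun w' => gm ρ (w' - z)

theorem Q_meas {n : ℕ} (ρ : ℝ) :
    Measurable fun z : EV n => densMeasure fun w' : EV n => gm ρ (w' - z) := by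
  apply dens_meas (F := fun z w' => gm ρ (w' - z))
  exact ((gm_continuous ρ).comp (by fun_prop : Continuous fun p : EV n × EV n => p.2 - p.1)).measurable

theorem cg_shift {n : ℕ} (ρ : ℝ) (z : EV n) : ∫ w, gm ρ (w - z) = cg n ρ :=
  integral_sub_right_eq_self (gm ρ) z

theorem Q_prob {n : ℕ} {ρ : ℝ} (hρ : 0 < ρ) (z : EV n) :
    IsProbabilityMeasure (densMeasure fun w' : EV n => gm ρ (w' - z)) :=
  dens_prob (gm_shift_integrable hρ z) (fun _ => (gm_pos _ _).le) (by rw [cg_shift]; exact cg_pos hρ)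

theorem Q_int {n : ℕ} {ρ : ℝ} (hρ : 0 < ρ) (z : EV n) (g : EV n → ℝ) :
    ∫ x, g x ∂(densMeasure fun w' : EV n => gm ρ (w' - z)) = Tf ρ g z := by
  rw [dens_int (f := fun w' : EV n => gm ρ (w' - z)) ((gm_continuous ρ).comp
    (by fun_prop : Continuous fun w' : EV n => w' - z)).measurable (gm_shift_integrable hρ z)
    (fun _ => (gm_pos _ _).le) (by rw [cg_shift]; exact cg_pos hρ), cg_shift, Tf]

section
variable {n : ℕ} {U : EV n → ℝ} {ρ : ℝ}

theorem Gf_cont1 (hU : Continuous U) (ρ : ℝ) (w : EV n) : Continuous (Gf U ρ w) :=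
  (Gf_continuous hU ρ).comp (by fun_prop : Continuous fun z => (w, z))

theorem G_prob (hU : Continuous U) (hUi : Integrable fun z => Real.exp (-U z)) (w : EV n) :
    IsProbabilityMeasure (densMeasure (Gf U ρ w)) :=
  dens_prob (Gf_integrable hU hUi ρ w) (fun _ => (Gf_pos _ _ _ _).le) (Wf_pos hU hUi ρ w)

theorem G_meas (hU : Continuous U) : Measurable fun w => densMeasure (Gf U ρ w) :=
  dens_meas (Gf_continuous hU ρ).measurable

theorem G_int (hU : Continuous U) (hUi : Integrable fun z => Real.exp (-U z)) (w : EV n) (h : EV n → ℝ) :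
    ∫ x, h x ∂(densMeasure (Gf U ρ w)) = Sf U ρ h w :=
  dens_int (Gf_cont1 hU ρ w).measurable (Gf_integrable hU hUi ρ w) (fun _ => (Gf_pos _ _ _ _).le)
    (Wf_pos hU hUi ρ w) h

theorem Pw_meas (hU : Continuous U) : Measurable (Pw U ρ) :=
  (Measure.measurable_bind' (Q_meas ρ)).comp (G_meas hU)

theorem Pw_prob (hU : Continuous U) (hUi : Integrable fun z => Real.exp (-U z)) (hρ : 0 < ρ) (w : EV n) :
    IsProbabilityMeasure (Pw U ρ w) :=
  have := G_prob (ρ := ρ) hU hUi w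
  bind_prob (Q_meas ρ) (Q_prob hρ)

theorem Pw_int (hU : Continuous U) (hUi : Integrable fun z => Real.exp (-U z)) (hρ : 0 < ρ) (w : EV n)
    {g : EV n → ℝ} {B : ℝ} (hg : Continuous g) (hB : ∀ x, |g x| ≤ B) :
    ∫ x, g x ∂(Pw U ρ w) = Pf U ρ g w := by
  have := G_prob (ρ := ρ) hU hUi w
  rw [Pw, bind_int (Q_meas ρ) (Q_prob hρ) hg hB]
  simp_rw [Q_int hρ]
  exact G_int hU hUi w _

theorem iter_prob (hU : Continuous U) (hUi : Integrable fun z => Real.exp (-U z)) (hρ : 0 < ρ)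
    (ν : Measure (EV n)) [hν : IsProbabilityMeasure ν] (t : ℕ) :
    IsProbabilityMeasure (iterDist (Pw U ρ) ν t) := by
  induction t with
  | zero => exact hν
  | succ k ih => exact bind_prob (Pw_meas hU) (Pw_prob hU hUi hρ)

theorem iter_int {m L B : ℝ} {g : EV n → ℝ} (hU : Continuous U) (hm : 0 < m)
    (hUi : Integrable fun z => Real.exp (-U z)) (hρ : 0 < ρ)
    (hsc : ConvexOn ℝ Set.univ fun z => U z - m / 2 * ‖z‖ ^ 2)
    (hL : 0 < L) (hg : Nice L B g)
    (ν : Measure (EV n)) [hν : IsProbabilityMeasure ν] (t : ℕ) :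
    ∫ x, g x ∂(iterDist (Pw U ρ) ν t) = ∫ x, (Pf U ρ)^[t] g x ∂ν := by
  induction t generalizing g L with
  | zero => rfl
  | succ k ih =>
    have := iter_prob hU hUi hρ ν k
    rw [iterDist, bind_int (Pw_meas hU) (Pw_prob hU hUi hρ) hg.cont hg.bdd]
    simp_rw [Pw_int hU hUi hρ _ hg.cont hg.bdd]
    exact ih (L := L / (1 + m * ρ ^ 2)) (g := Pf U ρ g) (by positivity)
      ((hg.T hρ).S hU hm hUi hρ hsc hL)

theorem Wf_meas (hU : Continuous U) : Measurable (Wf U ρ) :=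
  ((Gf_continuous hU ρ).stronglyMeasurable.integral_prod_right (ν := volume)).measurable

end

theorem w_space {d : ℕ} (hd : 0 < d) {U : EV d → ℝ} {m M : ℝ} (hm : 0 < m) (hM : 0 < M)
    (hUi : Integrable fun z : EV d => Real.exp (-U z))
    (hC2 : ContDiff ℝ 2 U)
    (hHess : ∀ (z v : EV d), |⟪v, fderiv ℝ (gradient U) z v⟫| ≤ M * ‖v‖ ^ 2)
    (hsc : ConvexOn ℝ Set.univ fun z => U z - m / 2 * ‖z‖ ^ 2)
    {w₀ : EV d} (hmin : ∀ w, U w₀ ≤ U w)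
    {ε : ℝ} (hε0 : 0 < ε) (hε1 : ε ≤ 1)
    {ρ : ℝ} (hρpos : 0 < ρ) (hρ : M * ρ ^ 2 * d ≤ ε) (t : ℕ)
    (ht : (Real.log (2 / ε) + (5 * d / 8 + d / 2 * Real.log (M / m)) / 2) /
        (m * ρ ^ 2 / (1 + m * ρ ^ 2)) ≤ t) {s : Set (EV d)} (hs : MeasurableSet s) :
    |(iterDist (Pw U ρ) (densMeasure (N0 M w₀)) t).real s -
      (densMeasure fun z => Real.exp (-U z)).real s| ≤ ε := by
  have hU := hC2.continuous
  have hN := N0_integrable hM w₀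
  have hNm : Measurable (N0 M w₀) := by
    have : Continuous (N0 M w₀) := by unfold N0; fun_prop
    exact this.measurable
  have hNI : 0 < ∫ w, N0 M w₀ w := by rw [N0_val hM]; positivity
  have hZ : 0 < ∫ z, Real.exp (-U z) := integral_exp_pos hUi
  have hcg := cg_pos (n := d) hρpos
  have hWI : 0 < ∫ w, Wf U ρ w := by
    rw [W_total hU hUi hρpos]
    exact mul_pos hcg hZ
  have hWi := Wf_integrable hUi hρpos
  have hWp : ∀ w, 0 ≤ Wf U ρ w := fun w => (Wf_pos hU hUi ρ w).le
  have hEm : Measurable fun z => Real.exp (-U z) := by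
    have : Continuous fun z => Real.exp (-U z) := by fun_prop
    exact this.measurable
  have p0 : IsProbabilityMeasure (densMeasure (N0 M w₀)) := dens_prob hN (fun _ => (Real.exp_pos _).le) hNI
  have p1 : IsProbabilityMeasure (densMeasure (Wf U ρ)) := dens_prob hWi hWp hWI
  have p2 : IsProbabilityMeasure (densMeasure fun z => Real.exp (-U z)) :=
    dens_prob hUi (fun _ => (Real.exp_pos _).le) hZ
  have p3 := iter_prob hU hUi hρpos (densMeasure (N0 M w₀)) t
  have hnum := numerics hd hm hM hε0 hε1 hρpos hρ t ht
  set μ := iterDist (Pw U ρ) (densMeasure (N0 M w₀)) t with hμ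
  have step1 : ∀ s : Set (EV d), MeasurableSet s → μ.real s ≤ (densMeasure (Wf U ρ)).real s + ε / 2 := by
    intro s hs
    refine tv_of_test (fun L g hL hg hg0 => ?_) hs
    rw [hμ, iter_int hU hm hUi hρpos hsc hL hg, dens_int hNm hN (fun _ => (Real.exp_pos _).le) hNI,
      dens_int (Wf_meas hU) hWi hWp hWI]
    have := conv_test hC2 hm hM hUi hρpos hHess hsc hmin hL hg hg0 t
    linarith [le_abs_self ((∫ w, (Pf U ρ)^[t] g w * N0 M w₀ w) / (∫ w, N0 M w₀ w) -
      (∫ w, g w * Wf U ρ w) / ∫ w, Wf U ρ w)]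
  have step2 : ∀ s : Set (EV d), MeasurableSet s →
      (densMeasure fun z => Real.exp (-U z)).real s ≤ (densMeasure (Wf U ρ)).real s + ε / 2 := by
    intro s hs
    have hle : Real.exp (-(M * ρ ^ 2 * d / 2)) * (densMeasure fun z => Real.exp (-U z)).real s ≤
        (densMeasure (Wf U ρ)).real s := by
      rw [dens_apply hEm hUi (fun _ => (Real.exp_pos _).le) hZ hs, dens_apply (Wf_meas hU) hWi hWp hWI hs,
        W_total hU hUi hρpos]
      have h1 : (∫ x in s, Real.exp (-U x)) * (cg d ρ * Real.exp (-(M * ρ ^ 2 * d / 2))) ≤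
          ∫ x in s, Wf U ρ x := by
        rw [← integral_mul_const]
        exact integral_mono (hUi.integrableOn.mul_const _) hWi.integrableOn
          fun w => W_low hC2 hM hρpos hUi hHess w
      rw [le_div_iff₀ (by positivity)]
      refine le_trans (le_of_eq ?_) h1
      field_simp
    have h1 : (densMeasure fun z => Real.exp (-U z)).real s ≤ 1 := measureReal_le_one
    have h2 : 0 ≤ (densMeasure fun z => Real.exp (-U z)).real s := measureReal_nonneg
    have h3 := Real.add_one_le_exp (-(M * ρ ^ 2 * d / 2))
    have h4 : 1 - ε / 2 ≤ Real.exp (-(M * ρ ^ 2 * d / 2)) := by linarith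
    nlinarith
  have hc : ∀ (μ : Measure (EV d)) [IsProbabilityMeasure μ], μ.real sᶜ = 1 - μ.real s := fun μ _ =>
    probReal_compl_eq_one_sub hs
  have a1 := step1 s hs
  have a2 := step1 sᶜ hs.compl
  have b1 := step2 s hs
  have b2 := step2 sᶜ hs.compl
  rw [hc, hc] at a2 b2
  rw [abs_le]
  constructor <;> linarith

theorem mvec_eq {n : ℕ} (A : Matrix (Fin n) (Fin n) ℝ) (x : EV n) : mvec A x = Matrix.toEuclideanLin A x := rfl

theorem mvec_mul {n : ℕ} (A B : Matrix (Fin n) (Fin n) ℝ) (x : EV n) :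
    mvec A (mvec B x) = mvec (A * B) x := by
  have h : (A *ᵥ (B *ᵥ x.ofLp)) = (A * B) *ᵥ x.ofLp := Matrix.mulVec_mulVec _ _ _
  exact congrArg (WithLp.toLp 2) h

theorem mvec_one {n : ℕ} (x : EV n) : mvec (1 : Matrix (Fin n) (Fin n) ℝ) x = x := by
  simp [mvec]

theorem mvec_sub {n : ℕ} (A : Matrix (Fin n) (Fin n) ℝ) (x y : EV n) :
    mvec A (x - y) = mvec A x - mvec A y := by
  simp only [mvec_eq, map_sub]

theorem mvec_cont {n : ℕ} (A : Matrix (Fin n) (Fin n) ℝ) : Continuous (mvec A) :=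
  LinearMap.continuous_of_finiteDimensional (Matrix.toEuclideanLin A)

theorem mvec_inner {n : ℕ} (A : Matrix (Fin n) (Fin n) ℝ) (u : EV n) :
    ⟪u, mvec (Aᵀ * A) u⟫ = ‖mvec A u‖ ^ 2 := by
  rw [← real_inner_self_eq_norm_sq, ← mvec_mul]
  rw [EuclideanSpace.inner_eq_star_dotProduct, EuclideanSpace.inner_eq_star_dotProduct]
  change (Aᵀ *ᵥ (A *ᵥ u.ofLp)) ⬝ᵥ star u.ofLp = (A *ᵥ u.ofLp) ⬝ᵥ star (A *ᵥ u.ofLp)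
  rw [star_trivial, star_trivial, Matrix.dotProduct_mulVec, Matrix.mulVec_transpose]

section
variable {n : ℕ} {A : Matrix (Fin n) (Fin n) ℝ}

theorem mvec_inv_left (hA : IsUnit A.det) (x : EV n) : mvec A⁻¹ (mvec A x) = x := by
  rw [mvec_mul, Matrix.nonsing_inv_mul _ hA, mvec_one]

theorem mvec_inv_right (hA : IsUnit A.det) (x : EV n) : mvec A (mvec A⁻¹ x) = x := by
  rw [mvec_mul, Matrix.mul_nonsing_inv _ hA, mvec_one]

theorem mvec_center (hA : IsUnit A.det) (z : EV n) :
    mvec A (mvec (Aᵀ * A)⁻¹ (mvec Aᵀ z)) = z := by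
  have hT : IsUnit (Aᵀ).det := by rwa [Matrix.det_transpose]
  rw [mvec_mul, mvec_mul, Matrix.mul_inv_rev, ← Matrix.mul_assoc, Matrix.mul_nonsing_inv _ hA,
    Matrix.one_mul, Matrix.nonsing_inv_mul _ hT, mvec_one]

theorem dens_comp (hA : IsUnit A.det) {f : EV n → ℝ} (hf : Measurable f) :
    densMeasure (fun θ => f (mvec A θ)) = (densMeasure f).map (mvec A⁻¹) := by
  have hdet : LinearMap.det (Matrix.toEuclideanLin A) ≠ 0 := by
    have h1 : (Matrix.toEuclideanLin A) ∘ₗ (Matrix.toEuclideanLin A⁻¹) = LinearMap.id := by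
      ext1 x
      exact mvec_inv_right hA x
    have h2 := congrArg LinearMap.det h1
    rw [LinearMap.det_comp, LinearMap.det_id] at h2
    exact left_ne_zero_of_mul_eq_one h2
  have hmap := Measure.map_linearMap_addHaar_eq_smul_addHaar (volume : Measure (EV n)) hdet
  set c := ENNReal.ofReal |(LinearMap.det (Matrix.toEuclideanLin A))⁻¹| with hc
  have hc0 : c ≠ 0 := by
    rw [hc, ne_eq, ENNReal.ofReal_eq_zero, not_le]
    exact abs_pos.2 (inv_ne_zero hdet)
  have hct : c ≠ ⊤ := ENNReal.ofReal_ne_top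
  have hmA := (mvec_cont A).measurable
  have hmB := (mvec_cont A⁻¹).measurable
  have hmap' : (volume : Measure (EV n)).map (mvec A) = c • volume := hmap
  have key : ∀ s : Set (EV n), MeasurableSet s →
      ∫⁻ θ in s, ENNReal.ofReal (f (mvec A θ)) = c * ∫⁻ w in (mvec A⁻¹) ⁻¹' s, ENNReal.ofReal (f w) := by
    intro s hs
    have h := setLIntegral_map (μ := (volume : Measure (EV n))) (hs.preimage hmB) hf.ennreal_ofReal hmA
    rw [hmap', Measure.restrict_smul, lintegral_smul_measure, ← Set.preimage_comp] at h
    have e : mvec A⁻¹ ∘ mvec A = id := funext fun x => mvec_inv_left hA x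
    rw [e, Set.preimage_id] at h
    exact h.symm
  have ku := key Set.univ MeasurableSet.univ
  rw [Set.preimage_univ, Measure.restrict_univ] at ku
  ext s hs
  rw [Measure.map_apply hmB hs]
  simp only [densMeasure, Measure.smul_apply, smul_eq_mul]
  rw [withDensity_apply _ hs, withDensity_apply _ (hs.preimage hmB), key s hs, ku,
    ENNReal.mul_inv (Or.inl hc0) (Or.inl hct)]
  calc _ = (c⁻¹ * c) * ((∫⁻ x, ENNReal.ofReal (f x))⁻¹ * ∫⁻ w in (mvec A⁻¹) ⁻¹' s, ENNReal.ofReal (f w)) := by ring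
    _ = _ := by rw [ENNReal.inv_mul_cancel hc0 hct, one_mul]

theorem bind_map_out {μ : Measure (EV n)} {P : EV n → Measure (EV n)} (hP : Measurable P)
    {f : EV n → EV n} (hf : Measurable f) :
    μ.bind (fun x => (P x).map f) = (μ.bind P).map f := by
  ext s hs
  rw [Measure.map_apply hf hs, Measure.bind_apply (f := fun x => (P x).map f) hs
      ((Measure.measurable_map f hf).comp hP).aemeasurable,
    Measure.bind_apply (hs.preimage hf) hP.aemeasurable]
  simp_rw [Measure.map_apply hf hs]

theorem map_bind_in {μ : Measure (EV n)} {P : EV n → Measure (EV n)} (hP : Measurable P)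
    {f : EV n → EV n} (hf : Measurable f) :
    (μ.map f).bind P = μ.bind (fun x => P (f x)) := by
  ext s hs
  rw [Measure.bind_apply hs hP.aemeasurable, Measure.bind_apply (f := fun x => P (f x)) hs (hP.comp hf).aemeasurable,
    lintegral_map (f := fun a => P a s) ((Measure.measurable_coe hs).comp hP) hf]

theorem kernel_eq (hA : IsUnit A.det) (U : EV n → ℝ) (ρ : ℝ) (θ : EV n) :
    sgsKernelSingle A U ρ θ = (Pw U ρ (mvec A θ)).map (mvec A⁻¹) := by
  have h : ∀ z : EV n, (densMeasure fun θ' : EV n =>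
        Real.exp (-(⟪θ' - mvec (Aᵀ * A)⁻¹ (mvec Aᵀ z),
            mvec (Aᵀ * A) (θ' - mvec (Aᵀ * A)⁻¹ (mvec Aᵀ z))⟫ / (2 * ρ ^ 2)))) =
      (densMeasure fun w' => gm ρ (w' - z)).map (mvec A⁻¹) := by
    intro z
    rw [← dens_comp hA (f := fun w' => gm ρ (w' - z)) ((gm_continuous ρ).comp
      (by fun_prop : Continuous fun w' : EV n => w' - z)).measurable]
    simp only [mvec_inner]
    simp only [mvec_sub, mvec_center hA, gm]
  unfold sgsKernelSingle
  simp_rw [h]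
  exact bind_map_out (Q_meas ρ) (mvec_cont A⁻¹).measurable

theorem iter_eq (hA : IsUnit A.det) {U : EV n → ℝ} (hU : Continuous U) (ρ : ℝ) (ν : Measure (EV n)) (t : ℕ) :
    iterDist (sgsKernelSingle A U ρ) (ν.map (mvec A⁻¹)) t = (iterDist (Pw U ρ) ν t).map (mvec A⁻¹) := by
  have hB := (mvec_cont A⁻¹).measurable
  have hK : Measurable (sgsKernelSingle A U ρ) := by
    have : sgsKernelSingle A U ρ = fun θ => (Pw U ρ (mvec A θ)).map (mvec A⁻¹) :=
      funext fun θ => kernel_eq hA U ρ θ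
    rw [this]
    exact (Measure.measurable_map _ hB).comp ((Pw_meas hU).comp (mvec_cont A).measurable)
  induction t with
  | zero => rfl
  | succ k ih =>
    rw [iterDist, ih, map_bind_in hK hB, iterDist, ← bind_map_out (Pw_meas hU) hB]
    simp_rw [kernel_eq hA, mvec_inv_right hA]

end

theorem stmt3 {d : ℕ} (hd : 0 < d)
    (A₁ : Matrix (Fin d) (Fin d) ℝ) (hA₁ : IsUnit A₁.det)
    (U₁ : EV d → ℝ) (m₁ M₁ : ℝ) (hm : 0 < m₁)
    -- (A0)
    (hA0bdd : BddBelow (Set.range U₁))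
    (hA0int : Integrable fun z : EV d => Real.exp (-U₁ z))
    -- (A2)
    (hC2 : ContDiff ℝ 2 U₁)
    (hHess : ∀ (z v : EV d), |⟪v, fderiv ℝ (gradient U₁) z v⟫| ≤ M₁ * ‖v‖ ^ 2)
    -- (A4)
    (hsc : ConvexOn ℝ Set.univ fun z => U₁ z - m₁ / 2 * ‖z‖ ^ 2)
    -- θ* is the unique minimizer of θ ↦ U₁(A₁θ)
    (θstar : EV d) (hmin : ∀ θ, U₁ (mvec A₁ θstar) ≤ U₁ (mvec A₁ θ))
    (ε : ℝ) (hε0 : 0 < ε) (hε1 : ε ≤ 1)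
    (ρ : ℝ) (hρpos : 0 < ρ) (hρ : ρ ^ 2 ≤ ε / (d * M₁))
    (t : ℕ)
    (ht : (Real.log (2 / ε) + (5 * d / 8 + d / 2 * Real.log (M₁ / m₁)) / 2) /
        (m₁ * ρ ^ 2 / (1 + m₁ * ρ ^ 2)) ≤ t) :
    tvDist
        (iterDist (sgsKernelSingle A₁ U₁ ρ)
          -- initial distribution ν = N(θ*, (M₁A₁ᵀA₁)⁻¹)
          (densMeasure fun θ : EV d =>
            Real.exp (-(M₁ * ⟪θ - θstar, mvec (A₁ᵀ * A₁) (θ - θstar)⟫ / 2))) t)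
        (densMeasure fun θ : EV d => Real.exp (-U₁ (mvec A₁ θ))) ≤ ε := by
  have hU := hC2.continuous
  have hd' : (0:ℝ) < d := by exact_mod_cast hd
  have hM : 0 < M₁ := by
    by_contra hcon
    have h1 : (d:ℝ) * M₁ ≤ 0 := mul_nonpos_of_nonneg_of_nonpos hd'.le (not_lt.1 hcon)
    have h2 : ε / (d * M₁) ≤ 0 := div_nonpos_of_nonneg_of_nonpos hε0.le h1
    have : 0 < ρ ^ 2 := by positivity
    linarith
  have hρ' : M₁ * ρ ^ 2 * d ≤ ε := by
    rw [le_div_iff₀ (by positivity)] at hρ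
    linarith
  have hmin' : ∀ w, U₁ (mvec A₁ θstar) ≤ U₁ w := fun w => by
    have := hmin (mvec A₁⁻¹ w)
    rwa [mvec_inv_right hA₁] at this
  have hB := (mvec_cont A₁⁻¹).measurable
  have e0 : (densMeasure fun θ : EV d =>
      Real.exp (-(M₁ * ⟪θ - θstar, mvec (A₁ᵀ * A₁) (θ - θstar)⟫ / 2))) =
      (densMeasure (N0 M₁ (mvec A₁ θstar))).map (mvec A₁⁻¹) := by
    have hc : Continuous (N0 M₁ (mvec A₁ θstar)) := by unfold N0; fun_prop
    rw [← dens_comp hA₁ hc.measurable]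
    congr 1
    ext θ
    rw [mvec_inner, N0, mvec_sub]
    congr 1; ring
  have hc : Continuous fun z => Real.exp (-U₁ z) := by fun_prop
  have e1 : (densMeasure fun θ : EV d => Real.exp (-U₁ (mvec A₁ θ))) =
      (densMeasure fun z => Real.exp (-U₁ z)).map (mvec A₁⁻¹) :=
    dens_comp hA₁ (f := fun z => Real.exp (-U₁ z)) hc.measurable
  rw [e0, e1, iter_eq hA₁ hU, tvDist]
  refine csSup_le ⟨_, ∅, MeasurableSet.empty, rfl⟩ ?_
  rintro r ⟨s, hs, rfl⟩
  rw [Measure.map_apply hB hs, Measure.map_apply hB hs]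
  exact w_space hd hm hM hA0int hC2 hHess hsc hmin' hε0 hε1 hρpos hρ' t ht (hs.preimage hB)

end
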